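/- arXiv:1210.4775 — 4 statements merged into one kernel-verified Lean document; each statement's English description precedes it below -/
import Mathlib

section
/- Let n, m ≥ 2. The monoid T_{n×m} of E-preserving full transformations of Fin n × Fin m is generated by the four elements {ξ1, ξ2, τ, τ̄}, and no subset of cardinality at most 3 generates T_{n×m}; thus the rank of T_{n×m} is 4. -/
/-- The monoid of full transformations of `Ω`, with left-to-right composition:
`(f * g) x = g (f x)`. -/
def FullT (Ω : Type) : Type := Ω → Ω

instance FullT.instOne {Ω : Type} : One (FullT Ω) := ⟨fun x => x⟩

instance FullT.instMul {Ω : Type} : Mul (FullT Ω) := ⟨fun f g x => g (f x)⟩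

instance FullT.instMonoid {Ω : Type} : Monoid (FullT Ω) where
  mul_assoc f g h := rfl
  one_mul f := rfl
  mul_one f := rfl

/-- A function `Ω → Ω` viewed as an element of the full transformation monoid. -/
def FullT.ofFun {Ω : Type} (f : Ω → Ω) : FullT Ω := f
/-- The permutation `s̄` of `Fin m` (0-indexed): the cycle `(2 3 ⋯ m)` if both `m`
and `n` are even, and the cycle `(1 2 ⋯ m)` otherwise. -/
def sbar (n m : ℕ) (hm : 2 ≤ m) : Equiv.Perm (Fin m) :=
  if Even m ∧ Even n then
    (finRotate m).trans (Equiv.swap (⟨0, by omega⟩ : Fin m) ⟨1, by omega⟩)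
  else finRotate m

/-- The permutation `ξ1` of `Fin n × Fin m` (all 0-indexed): it sends
`(i,1) ↦ ((0 1)i, s̄ 1)` and `(i,j) ↦ (i, s̄ j)` for `j ≠ 1`. -/
def xi1 (n m : ℕ) (hn : 2 ≤ n) (hm : 2 ≤ m) : Equiv.Perm (Fin n × Fin m) :=
  (Equiv.prodComm (Fin n) (Fin m)).trans
    ((Equiv.prodShear (sbar n m hm)
        (fun j => if j = (⟨1, by omega⟩ : Fin m) then
            Equiv.swap (⟨0, by omega⟩ : Fin n) ⟨1, by omega⟩
          else Equiv.refl (Fin n))).trans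
      (Equiv.prodComm (Fin m) (Fin n)))

/-- The permutation `ξ2` of `Fin n × Fin m` (all 0-indexed): it sends
`(i,0) ↦ ((0 1 ⋯ n-1)i, 1)`, `(i,1) ↦ (i,0)`, and fixes `(i,j)` for `j ≥ 2`. -/
def xi2 (n m : ℕ) (hn : 2 ≤ n) (hm : 2 ≤ m) : Equiv.Perm (Fin n × Fin m) :=
  (Equiv.prodComm (Fin n) (Fin m)).trans
    ((Equiv.prodShear (Equiv.swap (⟨0, by omega⟩ : Fin m) ⟨1, by omega⟩)
        (fun j => if j = (⟨0, by omega⟩ : Fin m) then finRotate n else Equiv.refl (Fin n))).trans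
      (Equiv.prodComm (Fin m) (Fin n)))
/-- `τ`: the full transformation of `Fin n × Fin m` sending `(0,0) ↦ (1,0)` (0-indexed)
and fixing all other points. -/
def tauF (n m : ℕ) (hn : 2 ≤ n) (hm : 2 ≤ m) : Fin n × Fin m → Fin n × Fin m :=
  fun p => if p = ((⟨0, by omega⟩ : Fin n), (⟨0, by omega⟩ : Fin m)) then
      ((⟨1, by omega⟩ : Fin n), (⟨0, by omega⟩ : Fin m))
    else p

/-- `τ̄`: the full transformation of `Fin n × Fin m` sending `(i,0) ↦ (i,1)` for every `i`
(0-indexed) and fixing all other points. -/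
def taubarF (n m : ℕ) (hm : 2 ≤ m) : Fin n × Fin m → Fin n × Fin m :=
  fun p => if p.2 = (⟨0, by omega⟩ : Fin m) then (p.1, (⟨1, by omega⟩ : Fin m)) else p

open Equiv

/-- The permutation `(i, j) ↦ (f j i, s j)` of `ι × κ`, permuting the blocks by `s`. -/
def wreathPerm {ι κ : Type} (f : κ → Perm ι) (s : Perm κ) : Perm (ι × κ) where
  toFun p := (f p.2 p.1, s p.2)
  invFun p := ((f (s⁻¹ p.2))⁻¹ p.1, s⁻¹ p.2)
  left_inv p := by simp
  right_inv p := by simp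

theorem wreathPerm_apply {ι κ : Type} (f : κ → Perm ι) (s : Perm κ) (p : ι × κ) :
    wreathPerm f s p = (f p.2 p.1, s p.2) := rfl

theorem wreathPerm_mul {ι κ : Type} (f g : κ → Perm ι) (s t : Perm κ) :
    wreathPerm f s * wreathPerm g t = wreathPerm (fun j => f (t j) * g j) (s * t) := by
  ext p <;> rfl

theorem wreathPerm_inv {ι κ : Type} (f : κ → Perm ι) (s : Perm κ) :
    (wreathPerm f s)⁻¹ = wreathPerm (fun j => (f (s⁻¹ j))⁻¹) s⁻¹ := by
  ext p <;> rfl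

/-- The permutations of `ι × κ` fixing every block. -/
def baseHom (ι κ : Type) : (κ → Perm ι) →* Perm (ι × κ) where
  toFun f := wreathPerm f 1
  map_one' := rfl
  map_mul' _ _ := rfl

theorem baseHom_apply {ι κ : Type} (f : κ → Perm ι) : baseHom ι κ f = wreathPerm f 1 := rfl

/-- Conjugating an element of the base group by an element of the wreath product. -/
theorem baseHom_mem_of_conj {ι κ : Type} {H : Subgroup (Perm (ι × κ))} {f g g' : κ → Perm ι}
    {s : Perm κ} (hf : wreathPerm f s ∈ H) (hg : baseHom ι κ g ∈ H)
    (h : ∀ j, g' (s j) = f j * g j * (f j)⁻¹) : baseHom ι κ g' ∈ H := by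
  have : baseHom ι κ g' = wreathPerm f s * baseHom ι κ g * (wreathPerm f s)⁻¹ := by
    rw [eq_mul_inv_iff_mul_eq, baseHom_apply, baseHom_apply, wreathPerm_mul, wreathPerm_mul]
    simp [h]
  rw [this]
  exact H.mul_mem (H.mul_mem hf hg) (H.inv_mem hf)

theorem wreathPerm_pow {ι κ : Type} (t : Perm ι) (e : κ → ℕ) (s : Perm κ) (k : ℕ) :
    wreathPerm (fun j => t ^ e j) s ^ k =
      wreathPerm (fun j => t ^ ∑ i ∈ Finset.range k, e ((s ^ i) j)) (s ^ k) := by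
  induction k with
  | zero => rfl
  | succ k ih =>
    rw [pow_succ', ih, wreathPerm_mul, pow_succ']
    congr 1
    funext j
    rw [Finset.sum_range_succ, add_comm, pow_add]

/-- If `s` is a cycle on `S`, the holonomy of a single twist `t` along `S` appears in every block
of `S`. -/
theorem wreathPerm_pow_card {ι κ : Type} [DecidableEq κ] (t : Perm ι) {s : Perm κ}
    {S : Finset κ} (hs : s.IsCycleOn S) (hfix : ∀ j ∉ S, s j = j) {a : κ} (ha : a ∈ S) :
    wreathPerm (Pi.mulSingle a t) s ^ S.card = baseHom ι κ (fun j => if j ∈ S then t else 1) := by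
  have h1 : (Pi.mulSingle a t : κ → Perm ι) = fun j => t ^ (if j = a then 1 else 0) := by
    funext j
    by_cases hj : j = a
    · subst hj; simp
    · simp [hj]
  have hfix' : ∀ j ∉ S, ∀ k : ℕ, (s ^ k) j = j := fun j hj k =>
    Function.IsFixedPt.perm_pow (hfix j hj) k
  rw [h1, wreathPerm_pow, baseHom_apply]
  congr 1
  · funext j
    by_cases hj : j ∈ S
    · rw [if_pos hj]
      obtain ⟨k, hk, hka⟩ := hs.exists_pow_eq hj ha
      rw [Finset.sum_eq_single k, if_pos hka, pow_one]
      · intro i hi hik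
        rw [if_neg]
        intro hia
        rw [← hka, hs.pow_apply_eq_pow_apply hj] at hia
        exact hik (hia.eq_of_lt_of_lt (Finset.mem_range.1 hi) hk)
      · intro h
        exact absurd (Finset.mem_range.2 hk) h
    · rw [if_neg hj, Finset.sum_eq_zero, pow_zero]
      intro i _
      rw [hfix' j hj, if_neg]
      rintro rfl
      exact hj ha
  · ext1 j
    by_cases hj : j ∈ S
    · exact hs.pow_card_apply hj
    · exact hfix' j hj _

theorem exists_perm_apply_pair {α : Type} [DecidableEq α] {a b c d : α} (hab : a ≠ b)
    (hcd : c ≠ d) : ∃ s : Perm α, s a = c ∧ s b = d := by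
  refine ⟨swap (swap a c b) d * swap a c, ?_, by simp⟩
  rw [Perm.mul_apply, swap_apply_left, swap_apply_of_ne_of_ne _ hcd]
  intro h
  have := congrArg (swap a c) h
  rw [swap_apply_right, swap_apply_self] at this
  exact hab this

/-- A normal subgroup of the symmetric group containing a transposition is the whole group. -/
theorem eq_top_of_swap_mem {α : Type} [DecidableEq α] [Finite α] (N : Subgroup (Perm α))
    [N.Normal] {a b : α} (hab : a ≠ b) (h : swap a b ∈ N) : N = ⊤ := by
  rw [eq_top_iff, ← Perm.closure_isSwap, Subgroup.closure_le]
  rintro _ ⟨c, d, hcd, rfl⟩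
  obtain ⟨s, rfl, rfl⟩ := exists_perm_apply_pair hab hcd
  rw [swap_apply_apply]
  exact ‹N.Normal›.conj_mem _ h s

/-- A subgroup of the symmetric group containing all commutators contains all even permutations. -/
theorem mem_of_sign_eq_one {α : Type} [DecidableEq α] [Fintype α] {N : Subgroup (Perm α)}
    (hN : ∀ u v : Perm α, u * v * u⁻¹ * v⁻¹ ∈ N) {g : Perm α} (hg : Perm.sign g = 1) : g ∈ N := by
  rw [← Perm.mem_alternatingGroup, ← Perm.closure_three_cycles_eq_alternating] at hg
  refine (Subgroup.closure_le N).2 ?_ hg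
  intro c hc
  have hsq : c * c = c⁻¹ := by
    have := pow_orderOf_eq_one c
    rw [Perm.IsThreeCycle.orderOf hc, pow_succ, pow_two] at this
    exact eq_inv_of_mul_eq_one_left this
  obtain ⟨u, hu⟩ := isConj_iff.1 (Perm.isConj_iff_cycleType_eq.2 (Perm.cycleType_inv c))
  have := hN u c⁻¹
  rw [hu, inv_inv, hsq] at this
  exact inv_mem_iff.1 this

/-- A subgroup of `{±1}^κ` containing all products of two basis elements and an element with an odd
number of negative entries is the whole group. -/
theorem eq_top_of_pair_mem_of_prod_eq_neg_one {κ : Type} [DecidableEq κ] [Fintype κ]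
    {L : Subgroup (κ → ℤˣ)}
    (hpair : ∀ i j, i ≠ j → (Pi.mulSingle i (-1) * Pi.mulSingle j (-1) : κ → ℤˣ) ∈ L)
    (hodd : ∃ e ∈ L, ∏ j, e j = -1) : L = ⊤ := by
  obtain ⟨e, he, hprod⟩ := hodd
  obtain ⟨a⟩ : Nonempty κ := by
    by_contra h
    rw [not_nonempty_iff] at h
    simp at hprod
  let φ : (κ → ℤˣ) →* (κ → ℤˣ) :=
    { toFun := fun z => z * Pi.mulSingle a (∏ j, z j)
      map_one' := by simp
      map_mul' := fun x y => by
        simp only [Pi.mul_apply, Finset.prod_mul_distrib, Pi.mulSingle_mul]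
        exact mul_mul_mul_comm _ _ _ _ }
  have hφ : ∀ z, φ z ∈ L := fun z => by
    refine Subgroup.pi_mem_of_mulSingle_mem (H := L.comap φ) z fun j => ?_
    have hj : φ (Pi.mulSingle j (z j)) = Pi.mulSingle j (z j) * Pi.mulSingle a (z j) := by
      simp [φ]
    rw [Subgroup.mem_comap, hj]
    rcases Int.units_eq_one_or (z j) with h | h <;> rw [h]
    · simp
    · by_cases hja : j = a
      · subst hja
        simp [← Pi.mulSingle_mul]
      · exact hpair j a hja
  have hneg : (Pi.mulSingle a (-1) : κ → ℤˣ) ∈ L := by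
    have := hφ e
    change e * Pi.mulSingle a (∏ j, e j) ∈ L at this
    rw [hprod] at this
    exact (L.mul_mem_cancel_left he).1 this
  rw [eq_top_iff]
  intro z _
  have := hφ z
  change z * Pi.mulSingle a (∏ j, z j) ∈ L at this
  refine (L.mul_mem_cancel_right ?_).1 this
  rcases Int.units_eq_one_or (∏ j, z j) with h | h <;> rw [h]
  · simp
  · exact hneg

/-- The base group lies in `H` as soon as there are at least three blocks, `H` induces the full
symmetric group on the blocks, contains enough elements supported on two blocks, and an element of
the base group whose product of signs is `-1`. -/
theorem baseHom_mem_of_three_le_card {ι κ : Type} [DecidableEq ι] [Fintype ι] [DecidableEq κ]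
    [Fintype κ] {H : Subgroup (Perm (ι × κ))} (hcard : 3 ≤ Fintype.card κ)
    (hs : ∀ s : Perm κ, ∃ f, wreathPerm f s ∈ H) {a b : κ} (hab : a ≠ b)
    (hpair : ∀ u : Perm ι, ∃ g, baseHom ι κ g ∈ H ∧ g a = u ∧ Perm.sign (g b) = Perm.sign u ∧
      ∀ j, j ≠ a → j ≠ b → g j = 1)
    (hodd : ∃ g, baseHom ι κ g ∈ H ∧ ∏ j, Perm.sign (g j) = -1) (g : κ → Perm ι) :
    baseHom ι κ g ∈ H := by
  have hpair' : ∀ i j, i ≠ j → ∀ u : Perm ι, ∃ g, baseHom ι κ g ∈ H ∧ g i = u ∧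
      Perm.sign (g j) = Perm.sign u ∧ ∀ k, k ≠ i → k ≠ j → g k = 1 := by
    intro i j hij u
    obtain ⟨s, rfl, rfl⟩ := exists_perm_apply_pair hab hij
    obtain ⟨f, hf⟩ := hs s
    obtain ⟨g, hg, hga, hgb, hgc⟩ := hpair ((f a)⁻¹ * u * f a)
    refine ⟨fun k => f (s⁻¹ k) * g (s⁻¹ k) * (f (s⁻¹ k))⁻¹,
      baseHom_mem_of_conj hf hg (by simp), ?_, ?_, ?_⟩
    · simp [hga, mul_assoc]
    · simp [hgb, mul_comm, mul_left_comm]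
    · intro k hka hkb
      have h1 : s⁻¹ k ≠ a := fun h => hka (by simp [← h])
      have h2 : s⁻¹ k ≠ b := fun h => hkb (by simp [← h])
      beta_reduce
      rw [hgc _ h1 h2, mul_one, mul_inv_cancel]
  have hsingle : ∀ i (u : Perm ι), Perm.sign u = 1 →
      baseHom ι κ (Pi.mulSingle i u) ∈ H := by
    intro i u hu
    refine mem_of_sign_eq_one
      (N := (H.comap (baseHom ι κ)).comap (MonoidHom.mulSingle (fun _ : κ => Perm ι) i)) ?_ hu
    intro v w
    obtain ⟨j, hji⟩ := Fintype.exists_ne_of_one_lt_card (by omega : 1 < Fintype.card κ) i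
    obtain ⟨k, hk⟩ : ∃ k, k ∉ ({i, j} : Finset κ) := by
      by_contra! h
      have h1 : Fintype.card κ ≤ ({i, j} : Finset κ).card :=
        Finset.card_le_card fun x _ => h x
      have h2 := Finset.card_le_two (a := i) (b := j)
      omega
    simp only [Finset.mem_insert, Finset.mem_singleton, not_or] at hk
    obtain ⟨x, hx, hxi, -, hx1⟩ := hpair' i j hji.symm v
    obtain ⟨y, hy, hyi, -, hy1⟩ := hpair' i k (Ne.symm hk.1) w
    have hxy : MonoidHom.mulSingle (fun _ : κ => Perm ι) i (v * w * v⁻¹ * w⁻¹) =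
        x * y * x⁻¹ * y⁻¹ := by
      funext l
      by_cases hli : l = i
      · subst hli
        simp [hxi, hyi]
      · by_cases hlj : l = j
        · subst hlj
          simp [hli, hy1 l hli (Ne.symm hk.2)]
        · simp [hli, hx1 l hli hlj]
    rw [Subgroup.mem_comap, hxy]
    exact mul_mem (mul_mem (mul_mem hx hy) (inv_mem hx)) (inv_mem hy)
  let σ : (κ → Perm ι) →* (κ → ℤˣ) := MonoidHom.compLeft Perm.sign κ
  have hker : ∀ g, σ g = 1 → baseHom ι κ g ∈ H := fun g hg =>
    Subgroup.pi_mem_of_mulSingle_mem (H := H.comap (baseHom ι κ)) g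
      fun i => hsingle i _ (congrFun hg i)
  have htop : (H.comap (baseHom ι κ)).map σ = ⊤ := by
    obtain ⟨e, he, hprod⟩ := hodd
    obtain ⟨t, ht⟩ : ∃ t : Perm ι, Perm.sign t = -1 := by
      by_contra! h
      have h1 : ∀ t : Perm ι, Perm.sign t = 1 := fun t =>
        (Int.units_eq_one_or _).resolve_right (h t)
      simp [h1] at hprod
    refine eq_top_of_pair_mem_of_prod_eq_neg_one ?_ ⟨σ e, ⟨e, he, rfl⟩, hprod⟩
    intro i j hij
    obtain ⟨x, hx, hxi, hxj, hx1⟩ := hpair' i j hij t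
    refine ⟨x, hx, ?_⟩
    funext l
    change Perm.sign (x l) = _
    by_cases hli : l = i
    · subst hli
      simp [hxi, ht, hij]
    · by_cases hlj : l = j
      · subst hlj
        simp [hxj, ht, hli]
      · simp [hli, hlj, hx1 l hli hlj]
  obtain ⟨x, hx, hxg⟩ : σ g ∈ (H.comap (baseHom ι κ)).map σ := by rw [htop]; trivial
  have := hker (x⁻¹ * g) (by rw [map_mul, map_inv, hxg, inv_mul_cancel])
  rw [map_mul, map_inv] at this
  exact (H.mul_mem_cancel_left (inv_mem hx)).1 this

/-- Variant for any number of blocks: it suffices that `H` contains a transposition inside a single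
block and induces the full symmetric group on that block. -/
theorem baseHom_mem_of_swap {ι κ : Type} [DecidableEq ι] [Finite ι] [DecidableEq κ] [Finite κ]
    {H : Subgroup (Perm (ι × κ))} (hs : ∀ s : Perm κ, ∃ f, wreathPerm f s ∈ H) {a : κ}
    {p q : ι} (hpq : p ≠ q)
    [((H.comap (baseHom ι κ)).comap (MonoidHom.mulSingle (fun _ : κ => Perm ι) a)).Normal]
    (hswap : baseHom ι κ (Pi.mulSingle a (swap p q)) ∈ H) (g : κ → Perm ι) :
    baseHom ι κ g ∈ H := by
  have htop := eq_top_of_swap_mem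
    ((H.comap (baseHom ι κ)).comap (MonoidHom.mulSingle (fun _ : κ => Perm ι) a)) hpq hswap
  refine Subgroup.pi_mem_of_mulSingle_mem (H := H.comap (baseHom ι κ)) g fun j => ?_
  obtain ⟨f, hf⟩ := hs (swap a j)
  have h1 : (f a)⁻¹ * g j * f a ∈
      (H.comap (baseHom ι κ)).comap (MonoidHom.mulSingle (fun _ : κ => Perm ι) a) := by
    rw [htop]; trivial
  refine baseHom_mem_of_conj hf h1 fun k => ?_
  by_cases hk : k = a
  · subst hk
    simp [mul_assoc]
  · have : swap a j k ≠ j := fun h => hk (by simpa using congrArg (swap a j) h)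
    simp [hk, this]

/-- The fibre over a block is normalised by every permutation that the base group part of `H`
induces on the block. -/
theorem mem_normalizer_comap_mulSingle {ι κ : Type} [DecidableEq κ]
    {H : Subgroup (Perm (ι × κ))} {g : κ → Perm ι} (hg : baseHom ι κ g ∈ H) (a : κ) :
    g a ∈ Subgroup.normalizer
      ((H.comap (baseHom ι κ)).comap (MonoidHom.mulSingle (fun _ : κ => Perm ι) a) :
        Set (Perm ι)) := by
  rw [Subgroup.mem_normalizer_iff]
  intro h
  have hconj : MonoidHom.mulSingle (fun _ : κ => Perm ι) a (g a * h * (g a)⁻¹) =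
      g * MonoidHom.mulSingle (fun _ : κ => Perm ι) a h * g⁻¹ := by
    funext j
    by_cases hj : j = a
    · subst hj; simp
    · simp [hj]
  simp only [Subgroup.mem_comap, hconj, map_mul, map_inv]
  rw [H.mul_mem_cancel_right (inv_mem hg), H.mul_mem_cancel_left hg]

theorem isCycleOn_finRotate (m : ℕ) :
    (finRotate (m + 1)).IsCycleOn (Finset.univ : Finset (Fin (m + 1))) := by
  cases m with
  | zero => exact @Perm.isCycleOn_of_subsingleton _ (inferInstanceAs (Subsingleton (Fin 1))) _ _
  | succ m =>
    have h : {x | finRotate (m + 2) x ≠ x} = ((Finset.univ : Finset (Fin (m + 2))) : Set _) := by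
      rw [← support_finRotate]
      ext x
      simp only [Finset.mem_coe, Perm.mem_support, Set.mem_ofPred_eq]
    exact h ▸ isCycle_finRotate.isCycleOn

theorem swap_mul_finRotate_zero (m : ℕ) :
    (swap 0 1 * finRotate (m + 2) : Perm (Fin (m + 2))) 0 = 0 := by
  simp

theorem swap_mul_finRotate_succ (m : ℕ) (x : Fin (m + 1)) :
    (swap 0 1 * finRotate (m + 2) : Perm (Fin (m + 2))) x.succ = (finRotate (m + 1) x).succ := by
  rw [Perm.mul_apply, finRotate_succ_eq_decomposeFin, Perm.decomposeFin_symm_apply_succ,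
    swap_apply_self]

theorem isCycleOn_swap_mul_finRotate (m : ℕ) :
    (swap 0 1 * finRotate (m + 2)).IsCycleOn (({0}ᶜ : Finset (Fin (m + 2))) : Set _) := by
  have hpow : ∀ (k : ℕ) (x : Fin (m + 1)),
      ((swap 0 1 * finRotate (m + 2) : Perm (Fin (m + 2))) ^ k) x.succ =
        ((finRotate (m + 1) ^ k) x).succ := by
    intro k
    induction k with
    | zero => intro x; rfl
    | succ k ih =>
      intro x
      rw [pow_succ', pow_succ', Perm.mul_apply, ih, swap_mul_finRotate_succ, Perm.mul_apply]
  constructor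
  · refine Equiv.bijOn _ fun x => ?_
    rw [Finset.mem_coe, Finset.mem_coe, Finset.mem_compl, Finset.mem_compl, Finset.mem_singleton,
      Finset.mem_singleton, not_iff_not]
    nth_rewrite 2 [← swap_mul_finRotate_zero m]
    exact (Equiv.injective _).eq_iff
  · intro x hx y hy
    obtain ⟨x, rfl⟩ := Fin.exists_succ_eq.2 (by simpa using hx : x ≠ 0)
    obtain ⟨y, rfl⟩ := Fin.exists_succ_eq.2 (by simpa using hy : y ≠ 0)
    obtain ⟨k, -, hk⟩ := (isCycleOn_finRotate m).exists_pow_eq (Finset.mem_univ x)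
      (Finset.mem_univ y)
    exact ⟨k, by rw [zpow_natCast, hpow, hk]⟩

theorem isCycleOn_finRotate_mul_swap (m : ℕ) :
    (finRotate (m + 2) * swap 0 1).IsCycleOn (({1}ᶜ : Finset (Fin (m + 2))) : Set _) := by
  have h := (isCycleOn_swap_mul_finRotate m).conj (g := swap 0 1)
  convert h using 1
  · rw [swap_inv, ← mul_assoc, swap_mul_self, one_mul]
  · ext x
    simp [Equiv.image_eq_preimage_symm, swap_apply_eq_iff]

theorem closure_finRotate_swap (n : ℕ) :
    Subgroup.closure {finRotate (n + 2), swap 0 1} = ⊤ := by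
  have := Perm.closure_cycle_adjacent_swap (isCycle_finRotate (n := n)) support_finRotate 0
  simpa using this

theorem prod_sign_ite_mem {ι κ : Type} [DecidableEq ι] [Fintype ι] [DecidableEq κ] [Fintype κ]
    (S : Finset κ) (p : Perm ι) :
    ∏ j, Perm.sign (if j ∈ S then p else 1) = Perm.sign p ^ S.card := by
  have h : ∀ j, Perm.sign (if j ∈ S then p else 1) = if j ∈ S then Perm.sign p else 1 :=
    fun j => by split_ifs <;> simp
  simp [h, Finset.prod_ite_mem]

/-- A normal subgroup of the symmetric group of odd degree containing `(1 2)(1 2 ⋯ n)` contains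
`(1 2)`. -/
theorem swap_mem_of_swap_mul_finRotate_mem {n : ℕ} (hn : Odd n)
    (N : Subgroup (Perm (Fin (n + 2)))) [N.Normal] (h : swap 0 1 * finRotate (n + 2) ∈ N) :
    swap 0 1 ∈ N := by
  rw [← QuotientGroup.eq_one_iff] at h ⊢
  rw [QuotientGroup.mk_mul] at h
  have hc : finRotate (n + 2) ^ (n + 2) = 1 := by
    have := pow_orderOf_eq_one (finRotate (n + 2))
    rwa [isCycle_finRotate.orderOf, support_finRotate, Finset.card_univ, Fintype.card_fin] at this
  have hsq : ((swap 0 1 : Perm (Fin (n + 2))) : Perm (Fin (n + 2)) ⧸ N) ^ 2 = 1 := by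
    rw [← QuotientGroup.mk_pow, pow_two, swap_mul_self, QuotientGroup.mk_one]
  have hinv := eq_inv_of_mul_eq_one_right h
  have h1 := congrArg (QuotientGroup.mk (s := N)) hc
  rw [QuotientGroup.mk_pow, hinv, inv_pow, QuotientGroup.mk_one, inv_eq_one] at h1
  obtain ⟨k, rfl⟩ := hn
  rwa [pow_add, hsq, mul_one, pow_succ, pow_mul, hsq, one_pow, one_mul] at h1

section Generation

variable {n m : ℕ} {H : Subgroup (Perm (Fin (n + 2) × Fin (m + 2)))}

theorem exists_wreathPerm_mem {f g : Fin (m + 2) → Perm (Fin (n + 2))}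
    (hx : wreathPerm f (finRotate (m + 2)) ∈ H) (hy : wreathPerm g (swap 0 1) ∈ H)
    (s : Perm (Fin (m + 2))) : ∃ f, wreathPerm f s ∈ H := by
  have hs : s ∈ Subgroup.closure {finRotate (m + 2), swap 0 1} := by
    rw [closure_finRotate_swap]; trivial
  induction hs using Subgroup.closure_induction with
  | mem s h =>
    rcases h with rfl | rfl
    · exact ⟨_, hx⟩
    · exact ⟨_, hy⟩
  | one => exact ⟨1, H.one_mem⟩
  | mul s t _ _ hs ht =>
    obtain ⟨f, hf⟩ := hs
    obtain ⟨g, hg⟩ := ht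
    exact ⟨_, wreathPerm_mul f g s t ▸ H.mul_mem hf hg⟩
  | inv s _ hs =>
    obtain ⟨f, hf⟩ := hs
    exact ⟨_, wreathPerm_inv f s ▸ H.inv_mem hf⟩

theorem baseHom_sq_mem
    (hy : wreathPerm (Pi.mulSingle 0 (finRotate (n + 2))) (swap 0 1) ∈ H) :
    baseHom (Fin (n + 2)) (Fin (m + 2))
      (fun j => if j ∈ ({0, 1} : Finset (Fin (m + 2))) then finRotate (n + 2) else 1) ∈ H := by
  have hcyc : (swap 0 1 : Perm (Fin (m + 2))).IsCycleOn
      (({0, 1} : Finset (Fin (m + 2))) : Set _) := by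
    simpa using Perm.isCycleOn_swap (a := (0 : Fin (m + 2))) (b := 1) (by simp)
  rw [← wreathPerm_pow_card _ hcyc (fun j hj => ?_) (by simp : (0 : Fin (m + 2)) ∈ _)]
  · exact H.pow_mem hy _
  · simp only [Finset.mem_insert, Finset.mem_singleton, not_or] at hj
    exact swap_apply_of_ne_of_ne hj.1 hj.2

theorem exists_pair_mem
    (hy : wreathPerm (Pi.mulSingle 0 (finRotate (n + 2))) (swap 0 1) ∈ H)
    {g : Fin (m + 2) → Perm (Fin (n + 2))} (hg : baseHom _ _ g ∈ H)
    (hgen : Subgroup.closure {finRotate (n + 2), g 0 * (g 1)⁻¹} = ⊤) (u : Perm (Fin (n + 2))) :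
    ∃ g, baseHom _ (Fin (m + 2)) g ∈ H ∧ g 0 = u ∧ Perm.sign (g 1) = Perm.sign u ∧
      ∀ j, j ≠ 0 → j ≠ 1 → g j = 1 := by
  have hu : u ∈ Subgroup.closure {finRotate (n + 2), g 0 * (g 1)⁻¹} := by rw [hgen]; trivial
  induction hu using Subgroup.closure_induction with
  | mem u h =>
    rcases h with rfl | rfl
    · refine ⟨_, baseHom_sq_mem hy, by simp, by simp, fun j h0 h1 => by simp [h0, h1]⟩
    · let c : Fin (m + 2) → Perm (Fin (n + 2)) := Pi.mulSingle 0 (finRotate (n + 2))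
      let g' : Fin (m + 2) → Perm (Fin (n + 2)) := fun j =>
        c (swap 0 1 j) * g (swap 0 1 j) * (c (swap 0 1 j))⁻¹
      have hg' : baseHom _ _ g' ∈ H := baseHom_mem_of_conj hy hg (by simp [g', c])
      refine ⟨g * g'⁻¹, by rw [map_mul, map_inv]; exact H.mul_mem hg (H.inv_mem hg'),
        by simp [g', c], ?_, fun j h0 h1 => ?_⟩
      · simp only [g', c, Pi.mul_apply, Pi.inv_apply, swap_apply_right, map_mul, map_inv,
          Int.units_inv_eq_self]
        rw [mul_right_comm _ (Perm.sign (g 0)), Int.units_mul_self, one_mul, mul_comm]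
      · simp [g', c, h0, swap_apply_of_ne_of_ne h0 h1]
  | one => exact ⟨1, by simp, by simp⟩
  | mul u v _ _ hu hv =>
    obtain ⟨g, hg, hg0, hg1, hg2⟩ := hu
    obtain ⟨k, hk, hk0, hk1, hk2⟩ := hv
    exact ⟨g * k, by rw [map_mul]; exact H.mul_mem hg hk, by simp [hg0, hk0],
      by simp [hg1, hk1], fun j h0 h1 => by simp [hg2 j h0 h1, hk2 j h0 h1]⟩
  | inv u _ hu =>
    obtain ⟨g, hg, hg0, hg1, hg2⟩ := hu
    exact ⟨g⁻¹, by rw [map_inv]; exact H.inv_mem hg, by simp [hg0],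
      by simp [hg1], fun j h0 h1 => by simp [hg2 j h0 h1]⟩

theorem normal_comap_mulSingle
    (hy : wreathPerm (Pi.mulSingle 0 (finRotate (n + 2))) (swap 0 1) ∈ H)
    {a : Fin (m + 2)} (ha : a = 0 ∨ a = 1)
    {g : Fin (m + 2) → Perm (Fin (n + 2))} (hg : baseHom _ _ g ∈ H) (hga : g a = swap 0 1) :
    ((H.comap (baseHom _ _)).comap
      (MonoidHom.mulSingle (fun _ : Fin (m + 2) => Perm (Fin (n + 2))) a)).Normal := by
  rw [← Subgroup.normalizer_eq_top_iff, eq_top_iff, ← closure_finRotate_swap, Subgroup.closure_le]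
  rintro _ (rfl | rfl)
  · have := mem_normalizer_comap_mulSingle (baseHom_sq_mem hy) a
    rcases ha with rfl | rfl <;> simpa using this
  · exact hga ▸ mem_normalizer_comap_mulSingle hg a

/-- Generation when the block permutation of the first generator is an `m`-cycle. -/
theorem baseHom_mem_of_finRotate
    (hy : wreathPerm (Pi.mulSingle 0 (finRotate (n + 2))) (swap 0 1) ∈ H)
    (hpar : ¬ (Even m ∧ Even n))
    (hx : wreathPerm (Pi.mulSingle 1 (swap 0 1)) (finRotate (m + 2)) ∈ H)
    (g : Fin (m + 2) → Perm (Fin (n + 2))) : baseHom _ _ g ∈ H := by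
  have hs := exists_wreathPerm_mem hx hy
  have hT : baseHom (Fin (n + 2)) (Fin (m + 2))
      (fun j => if j ∈ (Finset.univ : Finset (Fin (m + 2))) then swap 0 1 else 1) ∈ H := by
    rw [← wreathPerm_pow_card _ (isCycleOn_finRotate (m + 1)) (by simp) (Finset.mem_univ 1)]
    exact H.pow_mem hx _
  have hA : baseHom (Fin (n + 2)) (Fin (m + 2)) (fun j =>
      if j ∈ ({1}ᶜ : Finset (Fin (m + 2))) then swap 0 1 * finRotate (n + 2) else 1) ∈ H := by
    rw [← wreathPerm_pow_card _ (isCycleOn_finRotate_mul_swap m) (by simp)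
      (by simp : (0 : Fin (m + 2)) ∈ _)]
    refine H.pow_mem ?_ _
    have := H.mul_mem hx hy
    rw [wreathPerm_mul] at this
    convert this using 2
    funext j
    by_cases h0 : j = 0
    · subst h0; simp
    · have : swap 0 1 j ≠ 1 := fun h => h0 (by simpa using congrArg (swap 0 1) h)
      simp [h0, this]
  have hsign : Perm.sign (swap 0 1 * finRotate (n + 2)) = (-1) ^ n := by
    rw [map_mul, sign_finRotate, Perm.sign_swap (by simp)]
    simp [pow_succ]
  cases m with
  | zero =>
    have hn : Odd n := by simpa using hpar
    have hN := normal_comap_mulSingle hy (Or.inl rfl) hT (by simp)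
    refine baseHom_mem_of_swap hs (by simp : (0 : Fin (n + 2)) ≠ 1) (a := 0) ?_ g
    refine swap_mem_of_swap_mul_finRotate_mem hn _ (?_ : _ ∈ (H.comap (baseHom _ _)).comap
      (MonoidHom.mulSingle (fun _ : Fin 2 => Perm (Fin (n + 2))) 0))
    rw [Subgroup.mem_comap, Subgroup.mem_comap]
    convert hA using 2
    funext j
    fin_cases j <;> simp
  | succ m =>
    refine baseHom_mem_of_three_le_card (by simp) hs (by simp)
      (exists_pair_mem hy hA ?_) ?_ g
    · rw [eq_top_iff, ← closure_finRotate_swap, Subgroup.closure_le]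
      have h0 : finRotate (n + 2) ∈ Subgroup.closure {finRotate (n + 2),
        swap 0 1 * finRotate (n + 2)} := Subgroup.subset_closure (by simp)
      have h1 : swap 0 1 * finRotate (n + 2) ∈ Subgroup.closure {finRotate (n + 2),
        swap 0 1 * finRotate (n + 2)} := Subgroup.subset_closure (by simp)
      rintro _ (rfl | rfl)
      · simpa using h0
      · simpa using (Subgroup.mul_mem_cancel_right _ h0).1 h1
    · by_cases hm : Even (m + 1)
      · refine ⟨_, hA, ?_⟩
        rw [prod_sign_ite_mem, hsign, Finset.card_compl, Fintype.card_fin, Finset.card_singleton]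
        have hn : Odd n := by simpa [hm] using hpar
        have hm' : Odd (m + 1 + 2 - 1) := by
          rw [show m + 1 + 2 - 1 = m + 1 + 1 by omega]; exact hm.add_one
        rw [hn.neg_one_pow, hm'.neg_one_pow]
      · refine ⟨_, hT, ?_⟩
        rw [prod_sign_ite_mem, Perm.sign_swap (by simp), Finset.card_univ, Fintype.card_fin]
        rw [Nat.not_even_iff_odd] at hm
        exact (hm.add_even even_two).neg_one_pow

/-- Generation when the block permutation of the first generator is an `(m-1)`-cycle. -/
theorem baseHom_mem_of_swap_mul_finRotate
    (hy : wreathPerm (Pi.mulSingle 0 (finRotate (n + 2))) (swap 0 1) ∈ H)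
    (hm : Even m)
    (hx : wreathPerm (Pi.mulSingle 1 (swap 0 1)) (swap 0 1 * finRotate (m + 2)) ∈ H)
    (g : Fin (m + 2) → Perm (Fin (n + 2))) : baseHom _ _ g ∈ H := by
  have hs : ∀ s, ∃ f, wreathPerm f s ∈ H := by
    have := H.mul_mem hy hx
    rw [wreathPerm_mul, ← mul_assoc, swap_mul_self, one_mul] at this
    exact exists_wreathPerm_mem this hy
  have hA : baseHom (Fin (n + 2)) (Fin (m + 2)) (fun j =>
      if j ∈ ({0}ᶜ : Finset (Fin (m + 2))) then swap 0 1 else 1) ∈ H := by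
    rw [← wreathPerm_pow_card _ (isCycleOn_swap_mul_finRotate m) (by simp)
      (by simp : (1 : Fin (m + 2)) ∈ _)]
    exact H.pow_mem hx _
  cases m with
  | zero =>
    have hN := normal_comap_mulSingle hy (Or.inr rfl) hA (by simp)
    refine baseHom_mem_of_swap hs (by simp : (0 : Fin (n + 2)) ≠ 1) (a := 1) ?_ g
    convert hA using 2
    funext j
    fin_cases j <;> simp
  | succ m =>
    refine baseHom_mem_of_three_le_card (by simp) hs (by simp)
      (exists_pair_mem hy hA ?_) ⟨_, hA, ?_⟩ g
    · simpa using closure_finRotate_swap n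
    · rw [prod_sign_ite_mem, Perm.sign_swap (by simp), Finset.card_compl, Fintype.card_fin,
        Finset.card_singleton]
      have hm' : Odd (m + 1 + 2 - 1) := by
        rw [show m + 1 + 2 - 1 = m + 1 + 1 by omega]; exact hm.add_one
      exact hm'.neg_one_pow

end Generation

/-- The full transformation monoid of a finite set is generated by the permutations and a single
map of defect one. -/
theorem transformation_induction {α : Type} [DecidableEq α] [Finite α] {P : (α → α) → Prop}
    (hperm : ∀ s : Perm α, P s) {a b : α} (hab : a ≠ b) (hupd : P (Function.update id a b))
    (hcomp : ∀ f g, P f → P g → P (f ∘ g)) (f : α → α) : P f := by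
  have hupd' : ∀ c d, c ≠ d → P (Function.update id c d) := by
    intro c d hcd
    obtain ⟨s, rfl, rfl⟩ := exists_perm_apply_pair hab hcd
    have : Function.update id (s a) (s b) = s ∘ Function.update id a b ∘ (s⁻¹ : Perm α) := by
      funext x
      obtain ⟨x, rfl⟩ := s.surjective x
      by_cases hx : x = a
      · subst hx; simp
      · simp [hx]
    rw [this]
    exact hcomp _ _ (hperm s) (hcomp _ _ hupd (hperm _))
  induction hk : (Set.range f)ᶜ.ncard using Nat.strong_induction_on generalizing f with
  | _ k ih =>
    by_cases hf : Function.Injective f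
    · exact hperm (Equiv.ofBijective f (Finite.injective_iff_bijective.1 hf))
    · obtain ⟨c, hc⟩ : ∃ c, c ∉ Set.range f := by
        by_contra! h
        exact hf (Finite.injective_iff_surjective.2 h)
      simp only [Function.Injective, not_forall] at hf
      obtain ⟨x, y, hxy, hne⟩ := hf
      have hfac : f = Function.update f x c ∘ Function.update id x y := by
        funext z
        by_cases hz : z = x
        · subst hz
          simp [Ne.symm hne, hxy]
        · simp [hz]
      rw [hfac]
      refine hcomp _ _ (ih _ ?_ _ rfl) (hupd' x y hne)
      rw [← hk]
      refine Set.ncard_lt_ncard ?_ (Set.toFinite _)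
      refine compl_lt_compl_iff_lt.2 ⟨?_, fun h => hc (h ⟨x, by simp⟩)⟩
      rintro _ ⟨z, rfl⟩
      by_cases hz : z = x
      · subst hz
        exact ⟨y, by simp [Ne.symm hne, hxy]⟩
      · exact ⟨z, by simp [hz]⟩

/-- The monoid of transformations of `ι × κ` preserving the partition into blocks. -/
def blockMonoid (ι κ : Type) : Submonoid (FullT (ι × κ)) where
  carrier := {α | ∀ (i k : ι) (j : κ), (α (i, j)).2 = (α (k, j)).2}
  one_mem' _ _ _ := rfl
  mul_mem' {α β} hα hβ i k j := by
    change (β ((α (i, j)).1, (α (i, j)).2)).2 = (β (α (k, j))).2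
    rw [hα i k j]
    exact hβ _ _ _

theorem wreathPerm_mem_blockMonoid {ι κ : Type} (f : κ → Perm ι) (s : Perm κ) :
    FullT.ofFun (wreathPerm f s) ∈ blockMonoid ι κ := fun _ _ _ => rfl

/-- The map sending `(a, k)` to `(b, k)` and fixing all other points. -/
def collapsePoint {ι κ : Type} [DecidableEq ι] [DecidableEq κ] (a b : ι) (k : κ) :
    FullT (ι × κ) :=
  fun p => if p = (a, k) then (b, k) else p

/-- The map sending the block `k` identically to the block `l` and fixing all other points. -/
def collapseBlock (ι : Type) {κ : Type} [DecidableEq κ] (k l : κ) : FullT (ι × κ) :=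
  fun p => if p.2 = k then (p.1, l) else p

theorem snd_collapsePoint {ι κ : Type} [DecidableEq ι] [DecidableEq κ] (a b : ι) (k : κ)
    (p : ι × κ) : (collapsePoint a b k p).2 = p.2 := by
  rw [collapsePoint]
  split_ifs with hp <;> simp [hp]

theorem collapsePoint_mem_blockMonoid {ι κ : Type} [DecidableEq ι] [DecidableEq κ] (a b : ι)
    (k : κ) : collapsePoint a b k ∈ blockMonoid ι κ := by
  intro i i' j
  rw [snd_collapsePoint, snd_collapsePoint]

theorem collapseBlock_mem_blockMonoid {ι κ : Type} [DecidableEq κ] (k l : κ) :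
    collapseBlock ι k l ∈ blockMonoid ι κ := by
  intro i i' j
  by_cases hj : j = k <;> simp [collapseBlock, hj]

theorem blockMonoid_le_of_wreathPerm_mem {ι κ : Type} [DecidableEq ι] [Finite ι] [DecidableEq κ]
    [Finite κ] {C : Submonoid (FullT (ι × κ))}
    (hperm : ∀ f s, FullT.ofFun (wreathPerm f s) ∈ C) {a b : ι} (hab : a ≠ b) {k l : κ}
    (hkl : k ≠ l) (hpoint : collapsePoint a b k ∈ C) (hblock : collapseBlock ι k l ∈ C) :
    blockMonoid ι κ ≤ C := by
  have hψ : ∀ ψ : κ → κ, FullT.ofFun (fun p : ι × κ => (p.1, ψ p.2)) ∈ C := by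
    refine transformation_induction (fun s => hperm 1 s) hkl ?_
      fun f g hf hg => C.mul_mem hg hf
    convert hblock using 1
    funext p
    by_cases hp : p.2 = k
    · simp [FullT.ofFun, collapseBlock, hp]
    · simp [FullT.ofFun, collapseBlock, hp]
  have hsingle : ∀ (j : κ) (f : ι → ι),
      FullT.ofFun (fun p : ι × κ => if p.2 = j then (f p.1, p.2) else p) ∈ C := by
    intro j
    refine transformation_induction (fun s => ?_) hab ?_ fun f g hf hg => ?_
    · convert hperm (Pi.mulSingle j s) 1 using 1
      funext p
      obtain ⟨i, j'⟩ := p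
      by_cases hp : j' = j
      · subst hp
        simp [FullT.ofFun, wreathPerm_apply]
      · simp [FullT.ofFun, wreathPerm_apply, hp]
    · convert C.mul_mem (C.mul_mem (hperm 1 (swap j k)) hpoint) (hperm 1 (swap j k)) using 1
      funext p
      obtain ⟨i, j'⟩ := p
      change _ = wreathPerm 1 (swap j k) (collapsePoint a b k (i, swap j k j'))
      by_cases hp : j' = j
      · subst hp
        by_cases hi : i = a
        · subst hi
          simp [FullT.ofFun, wreathPerm_apply, collapsePoint]
        · simp [FullT.ofFun, wreathPerm_apply, collapsePoint, hi]
      · have h1 : swap j k j' ≠ k := fun h => hp (by simpa using congrArg (swap j k) h)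
        simp [FullT.ofFun, wreathPerm_apply, collapsePoint, hp, h1]
    · convert C.mul_mem hg hf using 1
      funext p
      change _ = (fun p : ι × κ => if p.2 = j then (f p.1, p.2) else p)
        (if p.2 = j then (g p.1, p.2) else p)
      by_cases hp : p.2 = j <;> simp [FullT.ofFun, hp]
  let S : Submonoid (κ → Function.End ι) :=
    { carrier := {φ | FullT.ofFun (fun p : ι × κ => (φ p.2 p.1, p.2)) ∈ C}
      one_mem' := C.one_mem
      mul_mem' := fun hφ hψ => C.mul_mem hψ hφ }
  have hS : ∀ (j : κ) (f : Function.End ι), Pi.mulSingle j f ∈ S := by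
    intro j f
    change FullT.ofFun _ ∈ C
    convert hsingle j f using 1
    funext p
    obtain ⟨i, j'⟩ := p
    by_cases hp : j' = j
    · subst hp
      simp [FullT.ofFun]
    · simp [FullT.ofFun, hp, Function.End.one_def]
  intro α hα
  have hφ : FullT.ofFun (fun p : ι × κ => ((α p).1, p.2)) ∈ C :=
    Submonoid.pi_mem_of_mulSingle_mem (f := fun _ => Function.End ι) (H := S)
      (fun j i => (α (i, j)).1) fun j => hS j _
  convert C.mul_mem hφ (hψ fun j => (α (a, j)).2) using 1
  funext p
  exact Prod.ext rfl (hα p.1 a p.2)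

/-- A transformation is injective on blocks if no two blocks are mapped into the same block. -/
def BlockInjective {ι κ : Type} (α : FullT (ι × κ)) : Prop :=
  ∀ i j k, (α (i, j)).2 = (α (i, k)).2 → j = k

theorem BlockInjective.mul {ι κ : Type} {α β : FullT (ι × κ)} (hα : BlockInjective α)
    (hβ : BlockInjective β) (hβ' : β ∈ blockMonoid ι κ) : BlockInjective (α * β) :=
  fun i j k h => hα i j k (hβ (α (i, j)).1 _ _ (h.trans (hβ' _ _ _)))

theorem BlockInjective.of_mul_left {ι κ : Type} {α β : FullT (ι × κ)}
    (h : BlockInjective (α * β)) (hβ : β ∈ blockMonoid ι κ) : BlockInjective α := by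
  refine fun i j k hjk => h i j k ?_
  change (β ((α (i, j)).1, (α (i, j)).2)).2 = (β (α (i, k))).2
  rw [hjk]
  exact hβ _ _ _

theorem BlockInjective.of_mul_right {ι κ : Type} {α β : FullT (ι × κ)}
    (h : BlockInjective (α * β)) (hα : α ∈ blockMonoid ι κ) (hβ : β ∈ blockMonoid ι κ)
    (hsurj : Function.Surjective α) : BlockInjective β := by
  intro i j k hjk
  obtain ⟨⟨i₁, j₁⟩, h₁⟩ := hsurj (i, j)
  obtain ⟨⟨i₂, k₁⟩, h₂⟩ := hsurj (i, k)
  have hjk₁ : j₁ = k₁ := by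
    refine h i₁ j₁ k₁ (Eq.trans ?_ ((blockMonoid ι κ).mul_mem hα hβ i₂ i₁ k₁))
    change (β (α (i₁, j₁))).2 = (β (α (i₂, k₁))).2
    rw [h₁, h₂, hjk]
  subst hjk₁
  have := hα i₁ i₂ j₁
  rwa [h₁, h₂] at this

theorem blockInjective_of_surjective {ι κ : Type} [Finite κ] {α : FullT (ι × κ)}
    (hα : α ∈ blockMonoid ι κ) (hsurj : Function.Surjective α) : BlockInjective α := by
  intro i
  refine (Finite.injective_iff_surjective (f := fun j => (α (i, j)).2)).2 fun j => ?_
  obtain ⟨⟨i', j'⟩, h⟩ := hsurj (i, j)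
  exact ⟨j', by simpa [h] using hα i i' j'⟩

section LowerBound

variable {ι κ : Type} {X : Set (FullT (ι × κ))}

theorem exists_not_blockInjective [DecidableEq κ] [Nonempty ι]
    (hX : Submonoid.closure X = blockMonoid ι κ) {k l : κ} (hkl : k ≠ l) :
    ∃ x ∈ X, ¬ BlockInjective x := by
  by_contra! h
  obtain ⟨a⟩ := ‹Nonempty ι›
  have hall : ∀ α ∈ Submonoid.closure X, BlockInjective α := by
    intro α hα
    induction hα using Submonoid.closure_induction with
    | mem x hx => exact h x hx
    | one => exact fun _ _ _ h => h
    | mul x y _ hy hx' hy' => exact hx'.mul hy' (hX ▸ hy)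
  have := hall (collapseBlock ι k l) (hX ▸ collapseBlock_mem_blockMonoid k l)
  exact hkl (this a k l (by simp [collapseBlock, Ne.symm hkl]))

theorem exists_blockInjective_not_bijective [DecidableEq ι] [DecidableEq κ]
    (hX : Submonoid.closure X = blockMonoid ι κ) {a b : ι} (hab : a ≠ b) (k : κ) :
    ∃ x ∈ X, BlockInjective x ∧ ¬ Function.Bijective x := by
  by_contra! h
  have hall : ∀ α ∈ Submonoid.closure X, BlockInjective α → Function.Bijective α := by
    intro α hα
    induction hα using Submonoid.closure_induction with
    | mem x hx => exact h x hx
    | one => exact fun _ => Function.bijective_id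
    | mul x y hx hy hx' hy' =>
      intro hxy
      rw [hX] at hx hy
      have hbij := hx' (hxy.of_mul_left hy)
      exact (hy' (hxy.of_mul_right hx hy hbij.2)).comp hbij
  have hbij := hall (collapsePoint a b k) (hX ▸ collapsePoint_mem_blockMonoid a b k) (by
    intro i j j' hjj'
    rwa [snd_collapsePoint, snd_collapsePoint] at hjj')
  have : ((a, k) : ι × κ) = (b, k) := hbij.1 (by simp [collapsePoint, Ne.symm hab])
  exact hab (congrArg Prod.fst this)

theorem exists_bijective_ne [DecidableEq ι] [DecidableEq κ] [Finite ι] [Finite κ]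
    (hX : Submonoid.closure X = blockMonoid ι κ) {a b : ι} (hab : a ≠ b) {k l : κ} (hkl : k ≠ l)
    (u : FullT (ι × κ)) : ∃ x ∈ X, Function.Bijective x ∧ x ≠ u := by
  by_contra! h
  have hall : ∀ α ∈ Submonoid.closure X, Function.Bijective α → α ∈ Submonoid.powers u := by
    intro α hα
    induction hα using Submonoid.closure_induction with
    | mem x hx => exact fun hbij => h x hx hbij ▸ Submonoid.mem_powers x
    | one => exact fun _ => Submonoid.one_mem _
    | mul x y hx hy hx' hy' =>
      intro hxy
      exact Submonoid.mul_mem _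
        (hx' (Finite.injective_iff_bijective.1 (Function.Injective.of_comp (f := y) hxy.1)))
        (hy' (Finite.surjective_iff_bijective.1 (Function.Surjective.of_comp (g := x) hxy.2)))
  have hmem : ∀ f s, FullT.ofFun (wreathPerm f s : ι × κ → ι × κ) ∈ Submonoid.powers u :=
    fun f s => hall _ (hX ▸ wreathPerm_mem_blockMonoid f s) (wreathPerm f s).bijective
  obtain ⟨p, hp⟩ := hmem 1 (swap k l)
  obtain ⟨q, hq⟩ := hmem (Pi.mulSingle k (swap a b)) 1
  have hcomm := ((Commute.refl u).pow_pow p q).eq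
  simp only at hp hq
  rw [hp, hq] at hcomm
  have := congrFun hcomm (a, k)
  change wreathPerm _ _ (wreathPerm _ _ (a, k)) = wreathPerm _ _ (wreathPerm _ _ (a, k)) at this
  simp [wreathPerm_apply, Ne.symm hkl, hab] at this

end LowerBound

theorem four_le_card_of_closure_eq {ι κ : Type} [DecidableEq ι] [DecidableEq κ] [Finite ι]
    [Finite κ] {X : Finset (FullT (ι × κ))}
    (hX : Submonoid.closure (X : Set (FullT (ι × κ))) = blockMonoid ι κ) {a b : ι} (hab : a ≠ b)
    {k l : κ} (hkl : k ≠ l) : 4 ≤ X.card := by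
  classical
  have : Nonempty ι := ⟨a⟩
  obtain ⟨u, hu, hub, -⟩ := exists_bijective_ne hX hab hkl 1
  obtain ⟨v, hv, hvb, hvu⟩ := exists_bijective_ne hX hab hkl u
  obtain ⟨x, hx, hxi, hxb⟩ := exists_blockInjective_not_bijective hX hab k
  obtain ⟨y, hy, hyi⟩ := exists_not_blockInjective hX hkl
  have hyb : ¬ Function.Bijective y := fun hyb =>
    hyi (blockInjective_of_surjective (hX ▸ Submonoid.subset_closure hy) hyb.2)
  have hcard : ({v, u, x, y} : Finset (FullT (ι × κ))).card = 4 := by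
    rw [Finset.card_insert_of_notMem, Finset.card_insert_of_notMem, Finset.card_pair]
    · rintro rfl; exact hyi hxi
    · simp only [Finset.mem_insert, Finset.mem_singleton, not_or]
      exact ⟨fun h => hxb (h ▸ hub), fun h => hyb (h ▸ hub)⟩
    · simp only [Finset.mem_insert, Finset.mem_singleton, not_or]
      exact ⟨hvu, fun h => hxb (h ▸ hvb), fun h => hyb (h ▸ hvb)⟩
  rw [← hcard]
  refine Finset.card_le_card fun z hz => ?_
  simp only [Finset.mem_insert, Finset.mem_singleton] at hz
  rcases hz with rfl | rfl | rfl | rfl <;> assumption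

theorem xi1_eq_wreathPerm (n m : ℕ) (hn : 2 ≤ n + 2) (hm : 2 ≤ m + 2) :
    xi1 (n + 2) (m + 2) hn hm =
      wreathPerm (Pi.mulSingle 1 (swap 0 1)) (sbar (n + 2) (m + 2) hm) := by
  have h : (Pi.mulSingle 1 (swap 0 1) : Fin (m + 2) → Perm (Fin (n + 2))) =
      fun j => if j = 1 then swap 0 1 else Equiv.refl _ := by
    funext j
    by_cases hj : j = 1
    · subst hj; simp
    · simp [hj]; rfl
  rw [h]
  rfl

theorem xi2_eq_wreathPerm (n m : ℕ) (hn : 2 ≤ n + 2) (hm : 2 ≤ m + 2) :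
    xi2 (n + 2) (m + 2) hn hm =
      wreathPerm (Pi.mulSingle 0 (finRotate (n + 2))) (swap 0 1) := by
  have h : (Pi.mulSingle 0 (finRotate (n + 2)) : Fin (m + 2) → Perm (Fin (n + 2))) =
      fun j => if j = 0 then finRotate (n + 2) else Equiv.refl _ := by
    funext j
    by_cases hj : j = 0
    · subst hj; simp
    · simp [hj]; rfl
  rw [h]
  rfl

/-- `ξ1` and `ξ2` generate the full wreath product. -/
theorem wreathPerm_mem_closure_xi (n m : ℕ) (hn : 2 ≤ n + 2) (hm : 2 ≤ m + 2)
    (f : Fin (m + 2) → Perm (Fin (n + 2))) (s : Perm (Fin (m + 2))) :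
    wreathPerm f s ∈
      Subgroup.closure {xi1 (n + 2) (m + 2) hn hm, xi2 (n + 2) (m + 2) hn hm} := by
  set H := Subgroup.closure {xi1 (n + 2) (m + 2) hn hm, xi2 (n + 2) (m + 2) hn hm}
  have hx : xi1 (n + 2) (m + 2) hn hm ∈ H := Subgroup.subset_closure (by simp)
  have hy : xi2 (n + 2) (m + 2) hn hm ∈ H := Subgroup.subset_closure (by simp)
  rw [xi1_eq_wreathPerm] at hx
  rw [xi2_eq_wreathPerm] at hy
  have key : (∀ g, baseHom _ _ g ∈ H) ∧ ∃ f, wreathPerm f s ∈ H := by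
    by_cases hpar : Even (m + 2) ∧ Even (n + 2)
    · have hsbar : sbar (n + 2) (m + 2) hm = swap 0 1 * finRotate (m + 2) := if_pos hpar
      rw [hsbar] at hx
      refine ⟨baseHom_mem_of_swap_mul_finRotate hy ((Nat.even_add.1 hpar.1).2 even_two) hx, ?_⟩
      have := H.mul_mem hy hx
      rw [wreathPerm_mul, ← mul_assoc, swap_mul_self, one_mul] at this
      exact exists_wreathPerm_mem this hy s
    · have hsbar : sbar (n + 2) (m + 2) hm = finRotate (m + 2) := if_neg hpar
      rw [hsbar] at hx
      refine ⟨baseHom_mem_of_finRotate hy (fun h => hpar ?_) hx, exists_wreathPerm_mem hx hy s⟩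
      exact ⟨h.1.add even_two, h.2.add even_two⟩
  obtain ⟨hbase, g, hg⟩ := key
  have := H.mul_mem hg (hbase fun j => (g j)⁻¹ * f j)
  rw [baseHom_apply, wreathPerm_mul] at this
  simpa using this

/-- The monoid `T_{n×m}` of `E`-preserving full transformations is generated by
`{ξ1, ξ2, τ, τ̄}`, and no subset of cardinality at most 3 generates it; its rank is 4. -/
theorem stmt12 (n m : ℕ) (hn : 2 ≤ n) (hm : 2 ≤ m) :
    ↑(Submonoid.closure
          {FullT.ofFun ⇑(xi1 n m hn hm), FullT.ofFun ⇑(xi2 n m hn hm),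
            FullT.ofFun (tauF n m hn hm), FullT.ofFun (taubarF n m hm)}) =
        {α : FullT (Fin n × Fin m) |
          ∀ (i k : Fin n) (j : Fin m), (α (i, j)).2 = (α (k, j)).2} ∧
      ∀ X : Finset (FullT (Fin n × Fin m)), X.card ≤ 3 →
        (X : Set (FullT (Fin n × Fin m))) ⊆
            {α | ∀ (i k : Fin n) (j : Fin m), (α (i, j)).2 = (α (k, j)).2} →
          ↑(Submonoid.closure (X : Set (FullT (Fin n × Fin m)))) ≠
            {α : FullT (Fin n × Fin m) |
              ∀ (i k : Fin n) (j : Fin m), (α (i, j)).2 = (α (k, j)).2} := by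
  obtain ⟨n, rfl⟩ := Nat.exists_eq_add_of_le' hn
  obtain ⟨m, rfl⟩ := Nat.exists_eq_add_of_le' hm
  have h01 : (0 : Fin (n + 2)) ≠ 1 := by simp
  have h01' : (0 : Fin (m + 2)) ≠ 1 := by simp
  constructor
  · refine congrArg _ (le_antisymm (b := blockMonoid _ _) ?_ ?_)
    · rw [Submonoid.closure_le]
      rintro _ (rfl | rfl | rfl | rfl)
      · rw [xi1_eq_wreathPerm]
        exact wreathPerm_mem_blockMonoid _ _
      · rw [xi2_eq_wreathPerm]
        exact wreathPerm_mem_blockMonoid _ _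
      · exact collapsePoint_mem_blockMonoid 0 1 0
      · exact collapseBlock_mem_blockMonoid 0 1
    · set C := Submonoid.closure {FullT.ofFun ⇑(xi1 (n + 2) (m + 2) hn hm),
        FullT.ofFun ⇑(xi2 (n + 2) (m + 2) hn hm), FullT.ofFun (tauF (n + 2) (m + 2) hn hm),
        FullT.ofFun (taubarF (n + 2) (m + 2) hm)}
      let D : Submonoid (Perm (Fin (n + 2) × Fin (m + 2))) :=
        { carrier := {e | FullT.ofFun e ∈ C}
          one_mem' := C.one_mem
          mul_mem' := fun {e f} he hf =>
            C.mul_mem (x := FullT.ofFun f) (y := FullT.ofFun e) hf he }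
      have hD : Submonoid.closure {xi1 (n + 2) (m + 2) hn hm, xi2 (n + 2) (m + 2) hn hm} ≤ D := by
        rw [Submonoid.closure_le]
        rintro _ (rfl | rfl)
        · exact Submonoid.subset_closure (by simp)
        · exact Submonoid.subset_closure (by simp)
      refine blockMonoid_le_of_wreathPerm_mem (fun f s => hD ?_) h01 h01'
        (Submonoid.subset_closure (Or.inr (Or.inr (Or.inl rfl))))
        (Submonoid.subset_closure (Or.inr (Or.inr (Or.inr rfl))))
      rw [← Subgroup.closure_toSubmonoid_of_finite]
      exact wreathPerm_mem_closure_xi n m hn hm f s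
  · intro X hcard _ hX
    have := four_le_card_of_closure_eq (X := X) (SetLike.coe_injective hX) h01 h01'
    omega
end

section
/- Let n, m ≥ 2. The monoid PT_{n×m} is generated by T_{n×m} together with the single element σ, the partial identity with domain Ω ∖ {(1,1)}: the submonoid of PT_{n×m} generated by T_{n×m} ∪ {σ} is all of PT_{n×m}. -/
/-- The monoid of partial transformations of `Ω`, encoded as functions
`Ω → Option Ω`; multiplication is left-to-right composition. -/
def PT (Ω : Type) : Type := Ω → Option Ω

instance PT.instOne {Ω : Type} : One (PT Ω) := ⟨fun x => some x⟩

instance PT.instMul {Ω : Type} : Mul (PT Ω) := ⟨fun f g x => (f x).bind g⟩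

instance PT.instMonoid {Ω : Type} : Monoid (PT Ω) where
  mul_assoc f g h := by
    funext x
    show ((f x).bind g).bind h = (f x).bind fun y => (g y).bind h
    cases f x <;> rfl
  one_mul f := rfl
  mul_one f := by
    funext x
    show (f x).bind (fun y => some y) = f x
    cases f x <;> rfl

/-- The empty partial transformation. -/
def PT.empty (Ω : Type) : PT Ω := fun _ => none

/-- A partial transformation of `Fin n × Fin m` preserves the uniform
equivalence `(i,j) E (k,l) ↔ j = l` if images of points in the same class
lie in the same class. -/
def PreservesE (n m : ℕ) (α : PT (Fin n × Fin m)) : Prop :=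
  ∀ (i k : Fin n) (j : Fin m) (a c : Fin n) (b d : Fin m),
    α (i, j) = some (a, b) → α (k, j) = some (c, d) → b = d
/-- `σ`: the partial identity of `Fin n × Fin m` with domain the complement of `{(0,0)}`. -/
def sigmaP (n m : ℕ) (hn : 2 ≤ n) (hm : 2 ≤ m) : PT (Fin n × Fin m) :=
  fun p => if p = ((⟨0, by omega⟩ : Fin n), (⟨0, by omega⟩ : Fin m)) then none else some p

namespace PT

theorem mul_apply_of_eq_none {Ω : Type} {f : PT Ω} {x : Ω} (h : f x = none) (g : PT Ω) :
    (f * g) x = none :=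
  Option.bind_eq_none_iff.2 fun y hy => by simp [h] at hy

theorem mul_apply_of_eq_some {Ω : Type} {f : PT Ω} {x y : Ω} (h : f x = some y) (g : PT Ω) :
    (f * g) x = g y :=
  congrArg (fun o : Option Ω => o.bind g) h

/-- A function regarded as a partial transformation. -/
def ofFun_s13 {Ω : Type} (f : Ω → Ω) : PT Ω := fun x => some (f x)

/-- The partial identity with domain the complement of `S`. -/
def idOff {Ω : Type} [DecidableEq Ω] (S : Finset Ω) : PT Ω :=
  fun x => if x ∈ S then none else some x

theorem idOff_of_mem {Ω : Type} [DecidableEq Ω] {S : Finset Ω} {x : Ω} (h : x ∈ S) :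
    idOff S x = none :=
  if_pos h

theorem idOff_of_notMem {Ω : Type} [DecidableEq Ω] {S : Finset Ω} {x : Ω} (h : x ∉ S) :
    idOff S x = some x :=
  if_neg h

theorem idOff_empty {Ω : Type} [DecidableEq Ω] : idOff (∅ : Finset Ω) = 1 := by
  funext x
  simp only [idOff, Finset.notMem_empty, if_false]
  rfl

theorem idOff_insert {Ω : Type} [DecidableEq Ω] (p : Ω) (S : Finset Ω) :
    idOff (insert p S) = idOff {p} * idOff S := by
  funext x
  by_cases h : x = p
  · rw [mul_apply_of_eq_none (idOff_of_mem (Finset.mem_singleton.2 h)),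
      idOff_of_mem (Finset.mem_insert.2 (Or.inl h))]
  · rw [mul_apply_of_eq_some (idOff_of_notMem (mt Finset.mem_singleton.1 h))]
    simp only [idOff, Finset.mem_insert, h, false_or]

/-- Conjugating a partial identity missing one point by an involution moves the missing point. -/
theorem idOff_singleton_conj {Ω : Type} [DecidableEq Ω] (f : Ω → Ω) (hf : Function.Involutive f)
    (p : Ω) :
    idOff {f p} = ofFun_s13 f * (idOff {p} * ofFun_s13 f) := by
  funext x
  have hx : f x = p ↔ x = f p := hf.eq_iff
  rw [mul_apply_of_eq_some (rfl : ofFun_s13 f x = some (f x))]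
  by_cases h : x = f p
  · rw [mul_apply_of_eq_none (idOff_of_mem (Finset.mem_singleton.2 (hx.2 h))),
      idOff_of_mem (Finset.mem_singleton.2 h)]
  · rw [mul_apply_of_eq_some (idOff_of_notMem (mt (hx.1 ∘ Finset.mem_singleton.1) h)),
      idOff_of_notMem (mt Finset.mem_singleton.1 h), ofFun_s13, hf x]

end PT

theorem preservesE_one (n m : ℕ) : PreservesE n m 1 := by
  intro i k j a c b d h₁ h₂
  have h₁ : (i, j) = (a, b) := Option.some.inj h₁
  have h₂ : (k, j) = (c, d) := Option.some.inj h₂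
  exact (Prod.ext_iff.1 h₁).2.symm.trans (Prod.ext_iff.1 h₂).2

theorem PreservesE.mul {n m : ℕ} {α β : PT (Fin n × Fin m)} (hα : PreservesE n m α)
    (hβ : PreservesE n m β) : PreservesE n m (α * β) := by
  intro i k j a c b d h₁ h₂
  obtain ⟨⟨a', b'⟩, h₁α, h₁β⟩ := Option.bind_eq_some_iff.1 h₁
  obtain ⟨⟨c', d'⟩, h₂α, h₂β⟩ := Option.bind_eq_some_iff.1 h₂
  obtain rfl := hα _ _ _ _ _ _ _ h₁α h₂α
  exact hβ _ _ _ _ _ _ _ h₁β h₂β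

theorem sigmaP_eq_idOff (n m : ℕ) (hn : 2 ≤ n) (hm : 2 ≤ m) :
    sigmaP n m hn hm = PT.idOff {(⟨0, by omega⟩, ⟨0, by omega⟩)} := by
  funext x
  simp only [sigmaP, PT.idOff, Finset.mem_singleton]

theorem preservesE_sigmaP (n m : ℕ) (hn : 2 ≤ n) (hm : 2 ≤ m) :
    PreservesE n m (sigmaP n m hn hm) := by
  intro i k j a c b d h₁ h₂
  simp only [sigmaP, Option.ite_none_left_eq_some, Option.some.injEq, Prod.mk.injEq] at h₁ h₂
  exact h₁.2.2.symm.trans h₂.2.2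

/-- A product of maps of the two coordinates preserves `E`. -/
theorem preservesE_prodMap {n m : ℕ} (f : Fin n → Fin n) (g : Fin m → Fin m) :
    PreservesE n m (PT.ofFun_s13 (Prod.map f g)) := by
  intro i k j a c b d h₁ h₂
  simp only [PT.ofFun_s13, Prod.map_apply, Option.some.injEq, Prod.mk.injEq] at h₁ h₂
  exact h₁.2.symm.trans h₂.2

/-- Every `E`-preserving partial transformation extends to a full one. -/
theorem PreservesE.exists_total_extension {n m : ℕ} {α : PT (Fin n × Fin m)}
    (hα : PreservesE n m α) :
    ∃ β : PT (Fin n × Fin m), (∀ x, β x ≠ none) ∧ PreservesE n m β ∧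
      ∀ x, α x ≠ none → β x = α x := by
  have hclass : ∀ j : Fin m, ∃ b : Fin m, ∀ i y, α (i, j) = some y → y.2 = b := by
    intro j
    by_cases h : ∃ i y, α (i, j) = some y
    · obtain ⟨i, y, hy⟩ := h
      exact ⟨y.2, fun k z hz => hα _ _ _ _ _ _ _ hz hy⟩
    · exact ⟨j, fun i y hy => (h ⟨i, y, hy⟩).elim⟩
  choose g hg using hclass
  have hβ : ∀ x y, some ((α x).getD (x.1, g x.2)) = some y → y.2 = g x.2 := by
    rintro ⟨i, j⟩ y hy
    cases h : α (i, j) with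
    | none => simp only [h, Option.getD_none, Option.some.injEq] at hy; rw [← hy]
    | some z =>
      simp only [h, Option.getD_some, Option.some.injEq] at hy
      exact hy ▸ hg j i z h
  refine ⟨fun x => some ((α x).getD (x.1, g x.2)), fun x => Option.some_ne_none _, ?_, ?_⟩
  · intro i k j a c b d h₁ h₂
    exact (hβ (i, j) (a, b) h₁).trans (hβ (k, j) (c, d) h₂).symm
  · intro x hx
    obtain ⟨y, hy⟩ := Option.ne_none_iff_exists'.1 hx
    simp [hy]

/-- A submonoid containing `σ` and the full `E`-preserving transformations contains every
partial identity. -/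
theorem idOff_mem {n m : ℕ} (hn : 2 ≤ n) (hm : 2 ≤ m) (M : Submonoid (PT (Fin n × Fin m)))
    (hT : ∀ α : PT (Fin n × Fin m), (∀ x, α x ≠ none) → PreservesE n m α → α ∈ M)
    (hσ : sigmaP n m hn hm ∈ M) (S : Finset (Fin n × Fin m)) : PT.idOff S ∈ M := by
  induction S using Finset.induction_on with
  | empty => rw [PT.idOff_empty]; exact M.one_mem
  | insert p S _ ih =>
    rw [PT.idOff_insert]
    refine M.mul_mem ?_ ih
    let f := Equiv.swap (⟨0, by omega⟩ : Fin n) p.1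
    let g := Equiv.swap (⟨0, by omega⟩ : Fin m) p.2
    have hinv : Function.Involutive (Prod.map f g) := fun x =>
      Prod.ext (Equiv.swap_apply_self _ _ _) (Equiv.swap_apply_self _ _ _)
    have hp : Prod.map f g (⟨0, by omega⟩, ⟨0, by omega⟩) = p :=
      Prod.ext (Equiv.swap_apply_left _ _) (Equiv.swap_apply_left _ _)
    have hfg := hT _ (fun x => Option.some_ne_none _) (preservesE_prodMap f g)
    rw [← hp, PT.idOff_singleton_conj _ hinv, ← sigmaP_eq_idOff n m hn hm]
    exact M.mul_mem hfg (M.mul_mem hσ hfg)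

/-- `PT_{n×m}` is generated by `T_{n×m}` (the `E`-preserving full transformations)
together with the single partial identity `σ` with domain `Ω \ {(0,0)}`. -/
theorem stmt13 (n m : ℕ) (hn : 2 ≤ n) (hm : 2 ≤ m) :
    ↑(Submonoid.closure
          ({α : PT (Fin n × Fin m) | (∀ x, α x ≠ none) ∧ PreservesE n m α} ∪
            {sigmaP n m hn hm})) =
      {α : PT (Fin n × Fin m) | PreservesE n m α} := by
  classical
  apply Set.Subset.antisymm
  · intro α hα
    refine Submonoid.closure_induction (motive := fun α _ => PreservesE n m α) ?_
      (preservesE_one n m) (fun _ _ _ _ => PreservesE.mul) hα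
    rintro α (hα | rfl)
    · exact hα.2
    · exact preservesE_sigmaP n m hn hm
  · intro α hα
    obtain ⟨β, hβ, hβE, hβα⟩ := PreservesE.exists_total_extension hα
    have hfactor : α = PT.idOff (Finset.univ.filter fun x => α x = none) * β := by
      funext x
      by_cases hx : α x = none
      · rw [PT.mul_apply_of_eq_none (PT.idOff_of_mem (by simpa using hx)), hx]
      · rw [PT.mul_apply_of_eq_some (PT.idOff_of_notMem (by simpa using hx)), hβα x hx]
    rw [hfactor, SetLike.mem_coe]
    have hT : ∀ γ : PT (Fin n × Fin m), (∀ x, γ x ≠ none) → PreservesE n m γ →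
        γ ∈ Submonoid.closure ({α : PT (Fin n × Fin m) | (∀ x, α x ≠ none) ∧ PreservesE n m α} ∪
          {sigmaP n m hn hm}) :=
      fun γ hγ hγE => Submonoid.subset_closure (Set.mem_union_left _ ⟨hγ, hγE⟩)
    have hσ := Submonoid.subset_closure (Set.mem_union_right
      {α : PT (Fin n × Fin m) | (∀ x, α x ≠ none) ∧ PreservesE n m α}
      (Set.mem_singleton (sigmaP n m hn hm)))
    exact Submonoid.mul_mem _ (idOff_mem hn hm _ hT hσ _) (hT β hβ hβE)
end

section
/- Let n, m ≥ 2. The set {ξ1, ξ2, τ, τ̄, σ} is a generating set of the monoid PT_{n×m} of minimal cardinality: its generated submonoid is all of PT_{n×m}, and no subset of PT_{n×m} of cardinality at most 4 generates PT_{n×m}. -/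
/-- A full transformation viewed as a partial transformation. -/
def PT.ofFun {Ω : Type} (f : Ω → Ω) : PT Ω := fun x => some (f x)
/-- The permutation `(i, j) ↦ (f j i, s j)` of `Fin n × Fin m`. -/
def wr {n m : ℕ} (f : Fin m → Equiv.Perm (Fin n)) (s : Equiv.Perm (Fin m)) :
    Equiv.Perm (Fin n × Fin m) :=
  (Equiv.prodComm (Fin n) (Fin m)).trans
    ((Equiv.prodShear s f).trans (Equiv.prodComm (Fin m) (Fin n)))

theorem wr_apply {n m : ℕ} (f : Fin m → Equiv.Perm (Fin n)) (s : Equiv.Perm (Fin m))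
    (p : Fin n × Fin m) : wr f s p = (f p.2 p.1, s p.2) := rfl

theorem wr_mul_wr {n m : ℕ} (f g : Fin m → Equiv.Perm (Fin n)) (s r : Equiv.Perm (Fin m)) :
    wr f s * wr g r = wr (fun j => f (r j) * g j) (s * r) := by
  ext1 p
  simp [wr_apply]

/-- The base group of the wreath product, embedded in `Perm (Fin n × Fin m)`. -/
def base {n m : ℕ} : (Fin m → Equiv.Perm (Fin n)) →* Equiv.Perm (Fin n × Fin m) where
  toFun f := wr f 1
  map_one' := rfl
  map_mul' _ _ := rfl

theorem base_apply {n m : ℕ} (f : Fin m → Equiv.Perm (Fin n)) (p : Fin n × Fin m) :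
    base f p = (f p.2 p.1, p.2) := rfl

theorem base_conj_mem {n m : ℕ} {H : Subgroup (Equiv.Perm (Fin n × Fin m))}
    {g f f' : Fin m → Equiv.Perm (Fin n)} {s : Equiv.Perm (Fin m)}
    (hw : wr g s ∈ H) (hf : base f ∈ H) (h : ∀ j, f' (s j) = g j * f j * (g j)⁻¹) :
    base f' ∈ H := by
  have key : base f' = wr g s * base f * (wr g s)⁻¹ := by
    rw [eq_mul_inv_iff_mul_eq]
    ext1 ⟨i, j⟩
    simp [wr_apply, base_apply, h]
  rw [key]
  exact H.mul_mem (H.mul_mem hw hf) (H.inv_mem hw)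

/-- The transposition of the first two points. -/
def tr (n : ℕ) (hn : 2 ≤ n) : Equiv.Perm (Fin n) :=
  Equiv.swap ⟨0, by omega⟩ ⟨1, by omega⟩

theorem tr_mul_self (n : ℕ) (hn : 2 ≤ n) : tr n hn * tr n hn = 1 :=
  Equiv.swap_mul_self _ _

theorem tr_inv (n : ℕ) (hn : 2 ≤ n) : (tr n hn)⁻¹ = tr n hn :=
  Equiv.swap_inv _ _

theorem val_finRotate {m : ℕ} (j : Fin m) :
    (finRotate m j).val = if j.val + 1 = m then 0 else j.val + 1 := by
  obtain _ | m := m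
  · exact j.elim0
  · rw [coe_finRotate]
    simp [Fin.ext_iff]

theorem val_tr_apply {m : ℕ} (hm : 2 ≤ m) (j : Fin m) :
    (tr m hm j).val = if j.val = 0 then 1 else if j.val = 1 then 0 else j.val := by
  simp only [tr, Equiv.swap_apply_def, Fin.ext_iff]
  split_ifs <;> rfl

theorem val_sbar_of_even {n m : ℕ} (hm : 2 ≤ m) (h : Even m ∧ Even n) (j : Fin m) :
    (sbar n m hm j).val =
      if j.val = 0 then 0 else if j.val + 1 = m then 1 else j.val + 1 := by
  have : sbar n m hm = tr m hm * finRotate m := by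
    rw [sbar, if_pos h]; rfl
  rw [this, Equiv.Perm.mul_apply, val_tr_apply, val_finRotate]
  grind

theorem val_sbar_of_not_even {n m : ℕ} (hm : 2 ≤ m) (h : ¬ (Even m ∧ Even n)) (j : Fin m) :
    (sbar n m hm j).val = if j.val + 1 = m then 0 else j.val + 1 := by
  rw [sbar, if_neg h, val_finRotate]

theorem xi1_eq_wr (n m : ℕ) (hn : 2 ≤ n) (hm : 2 ≤ m) :
    xi1 n m hn hm = wr (fun j => if j.val = 1 then tr n hn else 1) (sbar n m hm) := by
  ext1 ⟨i, j⟩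
  simp only [xi1, wr_apply, Equiv.trans_apply, Equiv.prodComm_apply, Prod.swap,
    Equiv.prodShear_apply, Fin.ext_iff]
  rfl

theorem xi2_eq_wr (n m : ℕ) (hn : 2 ≤ n) (hm : 2 ≤ m) :
    xi2 n m hn hm = wr (fun j => if j.val = 0 then finRotate n else 1) (tr m hm) := by
  ext1 ⟨i, j⟩
  simp only [xi2, wr_apply, Equiv.trans_apply, Equiv.prodComm_apply, Prod.swap,
    Equiv.prodShear_apply, Fin.ext_iff]
  rfl

theorem closure_finRotate_tr (m : ℕ) (hm : 2 ≤ m) :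
    Subgroup.closure {finRotate m, tr m hm} = ⊤ := by
  have h := Equiv.Perm.closure_cycle_adjacent_swap (isCycle_finRotate_of_le hm)
    (support_finRotate_of_le hm) (⟨0, by omega⟩ : Fin m)
  have e : finRotate m ⟨0, by omega⟩ = ⟨1, by omega⟩ := by
    ext
    rw [val_finRotate, if_neg (by simp; omega)]
  rwa [e] at h

theorem finRotate_pow_self (n : ℕ) (hn : 2 ≤ n) : finRotate n ^ n = 1 := by
  have h := (isCycle_finRotate_of_le hn).orderOf
  rw [support_finRotate_of_le hn, Finset.card_fin] at h
  rw [← orderOf_dvd_iff_pow_eq_one, h]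

/-- The powers of a permutation cycling the columns `1, …, m - 1`, with a twist by `t` out of
column `1` and a twist by `c` out of column `m - 1`. -/
theorem pow_cycle_apply {n m : ℕ} (hm : 2 ≤ m) (g : Equiv.Perm (Fin n × Fin m))
    (t c : Equiv.Perm (Fin n))
    (hg : ∀ (i : Fin n) (a : Fin m), 1 ≤ a.val →
      (g (i, a)).1 = (if a.val + 1 = m then c else 1) ((if a.val = 1 then t else 1) i) ∧
      (g (i, a)).2.val = if a.val + 1 = m then 1 else a.val + 1)
    (i : Fin n) (j : Fin m) (hj : 1 ≤ j.val) (k : ℕ) (hk : k ≤ m - 1) :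
    ((g ^ k) (i, j)).1 = (if m + 1 ≤ j.val + k then t else 1)
        ((if m ≤ j.val + k then c else 1) ((if j.val = 1 ∧ 1 ≤ k then t else 1) i)) ∧
      ((g ^ k) (i, j)).2.val = if j.val + k < m then j.val + k else j.val + k - (m - 1) := by
  induction k with
  | zero =>
    have := j.isLt
    constructor
    · rw [pow_zero]
      split_ifs <;> first | rfl | omega
    · simp
  | succ k ih =>
    obtain ⟨h1, h2⟩ := ih (by omega)
    have hjm := j.isLt
    rw [pow_succ', Equiv.Perm.mul_apply]
    generalize (g ^ k) (i, j) = p at h1 h2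
    obtain ⟨a, b⟩ := p
    simp only at h1 h2
    obtain ⟨h3, h4⟩ := hg a b (by rw [h2]; split_ifs <;> omega)
    rw [h3, h4, h1, h2]
    constructor
    · clear h3 h4 h1 h2 hg
      split_ifs <;> first | rfl | omega
    · split_ifs <;> omega

theorem pow_cycle_eq_base {n m : ℕ} (hm : 2 ≤ m) (g : Equiv.Perm (Fin n × Fin m))
    (t c : Equiv.Perm (Fin n))
    (h0 : ∀ (i : Fin n) (a : Fin m), a.val = 0 → g (i, a) = (i, a))
    (hg : ∀ (i : Fin n) (a : Fin m), 1 ≤ a.val →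
      (g (i, a)).1 = (if a.val + 1 = m then c else 1) ((if a.val = 1 then t else 1) i) ∧
      (g (i, a)).2.val = if a.val + 1 = m then 1 else a.val + 1) :
    g ^ (m - 1) =
      base (fun j => if j.val = 0 then 1 else if j.val = 1 then c * t else t * c) := by
  ext1 ⟨i, j⟩
  rw [base_apply]
  by_cases hj : j.val = 0
  · have h : Function.IsFixedPt g (i, j) := h0 i j hj
    rw [Equiv.Perm.coe_pow, (h.iterate (m - 1)).eq]
    simp [hj]
  · obtain ⟨h1, h2⟩ := pow_cycle_apply hm g t c hg i j (by omega) (m - 1) le_rfl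
    have := j.isLt
    refine Prod.ext ?_ (Fin.ext ?_)
    · rw [h1]
      simp only
      split_ifs <;> first | rfl | omega
    · rw [h2]
      simp only
      split_ifs <;> omega

/-- The powers of a permutation cycling all the columns, with a twist by `t` out of column `1`. -/
theorem pow_rotate_apply {n m : ℕ} (hm : 2 ≤ m) (g : Equiv.Perm (Fin n × Fin m))
    (t : Equiv.Perm (Fin n))
    (hg : ∀ (i : Fin n) (a : Fin m),
      (g (i, a)).1 = (if a.val = 1 then t else 1) i ∧
      (g (i, a)).2.val = if a.val + 1 = m then 0 else a.val + 1)
    (i : Fin n) (j : Fin m) (k : ℕ) (hk : k ≤ m) :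
    ((g ^ k) (i, j)).1 =
        (if (j.val ≤ 1 ∧ 2 ≤ j.val + k) ∨ m + 2 ≤ j.val + k then t else 1) i ∧
      ((g ^ k) (i, j)).2.val = if j.val + k < m then j.val + k else j.val + k - m := by
  induction k with
  | zero =>
    have := j.isLt
    constructor
    · rw [pow_zero]
      split_ifs <;> first | rfl | omega
    · simp
  | succ k ih =>
    obtain ⟨h1, h2⟩ := ih (by omega)
    have hjm := j.isLt
    rw [pow_succ', Equiv.Perm.mul_apply]
    generalize (g ^ k) (i, j) = p at h1 h2
    obtain ⟨a, b⟩ := p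
    simp only at h1 h2
    obtain ⟨h3, h4⟩ := hg a b
    rw [h3, h4, h1, h2]
    constructor
    · clear h3 h4 h1 h2 hg
      split_ifs <;> first | rfl | omega
    · split_ifs <;> omega

theorem pow_rotate_eq_base {n m : ℕ} (hm : 2 ≤ m) (g : Equiv.Perm (Fin n × Fin m))
    (t : Equiv.Perm (Fin n))
    (hg : ∀ (i : Fin n) (a : Fin m),
      (g (i, a)).1 = (if a.val = 1 then t else 1) i ∧
      (g (i, a)).2.val = if a.val + 1 = m then 0 else a.val + 1) :
    g ^ m = base (fun _ => t) := by
  ext1 ⟨i, j⟩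
  obtain ⟨h1, h2⟩ := pow_rotate_apply hm g t hg i j m le_rfl
  have := j.isLt
  refine Prod.ext ?_ (Fin.ext ?_)
  · rw [h1, if_pos (by omega), base_apply]
  · rw [h2, if_neg (by omega), base_apply, Nat.add_sub_cancel]

section Generation

variable {n m : ℕ} (hn : 2 ≤ n) (hm : 2 ≤ m) {H : Subgroup (Equiv.Perm (Fin n × Fin m))}

theorem base_rotate_pair_mem (h2 : xi2 n m hn hm ∈ H) :
    base (fun j : Fin m => if j.val ≤ 1 then finRotate n else 1) ∈ H := by
  have e : base (fun j : Fin m => if j.val ≤ 1 then finRotate n else 1) =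
      xi2 n m hn hm * xi2 n m hn hm := by
    rw [xi2_eq_wr]
    ext1 ⟨i, j⟩
    refine Prod.ext ?_ (Fin.ext ?_)
    · simp only [Equiv.Perm.mul_apply, wr_apply, base_apply, val_tr_apply]
      split_ifs <;> first | rfl | omega | contradiction
    · simp only [Equiv.Perm.mul_apply, wr_apply, base_apply, val_tr_apply]
      split_ifs <;> first | rfl | omega | contradiction
  rw [e]
  exact H.mul_mem h2 h2

theorem base_first_tr_mem_of_even (h : Even m ∧ Even n) (h1 : xi1 n m hn hm ∈ H)
    (h2 : xi2 n m hn hm ∈ H) :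
    base (fun j : Fin m => if j.val = 0 then tr n hn else 1) ∈ H := by
  have hs := val_sbar_of_even (n := n) hm h
  have tt := tr_mul_self n hn
  have ti := tr_inv n hn
  have w1 := xi1_eq_wr n m hn hm ▸ h1
  have w2 := xi2_eq_wr n m hn hm ▸ h2
  have hT : base (fun j : Fin m => if j.val = 0 then 1 else tr n hn) ∈ H := by
    have e := pow_cycle_eq_base hm (xi1 n m hn hm) (tr n hn) 1 ?_ ?_
    · have : base (fun j : Fin m => if j.val = 0 then 1 else tr n hn) =
          xi1 n m hn hm ^ (m - 1) := by
        rw [e]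
        congr 1
        funext j
        simp
      rw [this]
      exact H.pow_mem h1 _
    · intro i a ha
      rw [xi1_eq_wr, wr_apply]
      refine Prod.ext ?_ (Fin.ext ?_)
      · simp [ha]
      · simp [hs, ha]
    · intro i a ha
      rw [xi1_eq_wr, wr_apply]
      refine ⟨?_, ?_⟩
      · simp
      · simp only [hs]
        rw [if_neg (by omega)]
  have hD : base (fun j : Fin m => if j.val = 1 then 1 else tr n hn) ∈ H := by
    refine base_conj_mem w2 hT fun j => ?_
    simp only [val_tr_apply]
    split_ifs <;> first | omega | contradiction | (exfalso; lia) | simp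
  have hQ : ∀ k : ℕ, 1 ≤ k → k < m →
      base (fun j : Fin m => if j.val = 0 ∨ j.val = k then tr n hn else 1) ∈ H := by
    intro k hk
    induction k, hk using Nat.le_induction with
    | base =>
      intro _
      have := H.mul_mem hD hT
      rw [← map_mul] at this
      convert this using 2
      funext j
      simp only [Pi.mul_apply]
      split_ifs <;> first | omega | simp [tt]
    | succ k hk ih =>
      intro hkm
      refine base_conj_mem w1 (ih (by omega)) fun j => ?_
      have := j.isLt
      simp only [hs]
      split_ifs <;> first | omega | contradiction | (exfalso; lia) | simp
  have hW : ∀ k : ℕ, k < m →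
      base (fun j : Fin m => if j.val = 0 then tr n hn ^ k else
        if j.val ≤ k then 1 else tr n hn) ∈ H := by
    intro k
    induction k with
    | zero =>
      intro _
      convert hT using 3
      split_ifs <;> first | omega | contradiction | (exfalso; lia) | simp
    | succ k ih =>
      intro hk
      have := H.mul_mem (ih (by omega)) (hQ (k + 1) (by omega) hk)
      rw [← map_mul] at this
      convert this using 2
      funext j
      simp only [Pi.mul_apply]
      split_ifs <;> first | omega | simp [tt, pow_succ]
  have := hW (m - 1) (by omega)
  convert this using 3 with j
  have hj := j.isLt
  have hpow : tr n hn ^ (m - 1) = tr n hn := by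
    have ho : Odd (m - 1) := Nat.Even.sub_odd (by omega) h.1 odd_one
    obtain ⟨k, hk⟩ := ho
    rw [hk, pow_succ, pow_mul, pow_two, tt, one_pow, one_mul]
  rw [hpow]
  split_ifs <;> first | rfl | omega

theorem base_twisted_mem (h : ¬ (Even m ∧ Even n)) (h1 : xi1 n m hn hm ∈ H)
    (h2 : xi2 n m hn hm ∈ H) :
    base (fun j : Fin m => if j.val = 0 then tr n hn else
      if j.val = 1 then finRotate n else tr n hn * finRotate n * (tr n hn)⁻¹) ∈ H := by
  have hs := val_sbar_of_not_even (n := n) hm h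
  have tt := tr_mul_self n hn
  have ti := tr_inv n hn
  have hT : base (fun _ : Fin m => tr n hn) ∈ H := by
    have e := pow_rotate_eq_base hm (xi1 n m hn hm) (tr n hn) ?_
    · rw [← e]
      exact H.pow_mem h1 _
    · intro i a
      rw [xi1_eq_wr, wr_apply]
      exact ⟨rfl, hs a⟩
  have hR := H.pow_mem (H.mul_mem h2 h1) (m - 1)
  rw [pow_cycle_eq_base hm (xi2 n m hn hm * xi1 n m hn hm) (tr n hn) (finRotate n) ?_ ?_] at hR
  · have := H.mul_mem hR hT
    rw [← map_mul] at this
    convert this using 2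
    funext j
    simp only [Pi.mul_apply]
    split_ifs <;> simp [mul_assoc, tt, ti]
  · intro i a ha
    rw [xi1_eq_wr, xi2_eq_wr, Equiv.Perm.mul_apply]
    refine Prod.ext ?_ (Fin.ext ?_)
    · simp only [wr_apply, hs]
      split_ifs <;> first | rfl | omega | contradiction
    · simp only [wr_apply, hs, val_tr_apply]
      split_ifs <;> first | rfl | omega | contradiction
  · intro i a ha
    rw [xi1_eq_wr, xi2_eq_wr, Equiv.Perm.mul_apply]
    simp only [wr_apply, hs, val_tr_apply]
    constructor <;> split_ifs <;> first | rfl | omega | contradiction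

theorem base_first_tr_mem_of_odd_right (h : Odd n) (h1 : xi1 n m hn hm ∈ H)
    (h2 : xi2 n m hn hm ∈ H) :
    base (fun j : Fin m => if j.val = 0 then tr n hn else 1) ∈ H := by
  have hne : ¬ (Even m ∧ Even n) := fun he => Nat.not_even_iff_odd.mpr h he.2
  have tt := tr_mul_self n hn
  have := H.pow_mem (base_twisted_mem hn hm hne h1 h2) n
  rw [← map_pow] at this
  convert this using 2
  funext j
  have hpow : tr n hn ^ n = tr n hn := by
    obtain ⟨k, hk⟩ := h
    have : ∀ l, l = 2 * k + 1 → tr n hn ^ l = tr n hn := by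
      rintro _ rfl
      rw [pow_succ, pow_mul, pow_two, tt, one_pow, one_mul]
    exact this n hk
  simp only [Pi.pow_apply]
  split_ifs
  · exact hpow.symm
  · exact (finRotate_pow_self n hn).symm
  · rw [conj_pow, finRotate_pow_self n hn, mul_one, mul_inv_cancel]

theorem base_first_tr_mem_of_odd_left (h : Odd m) (h1 : xi1 n m hn hm ∈ H)
    (h2 : xi2 n m hn hm ∈ H) :
    base (fun j : Fin m => if j.val = 0 then tr n hn else 1) ∈ H := by
  have hne : ¬ (Even m ∧ Even n) := fun he => Nat.not_even_iff_odd.mpr h he.1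
  have hs := val_sbar_of_not_even (n := n) hm hne
  have w1 := xi1_eq_wr n m hn hm ▸ h1
  have hp : ∀ k : ℕ, 1 ≤ k → k + 1 < m →
      base (fun j : Fin m => if j.val = k ∨ j.val = k + 1 then
        (if j.val = 1 then finRotate n else tr n hn * finRotate n * (tr n hn)⁻¹) else 1) ∈ H := by
    intro k hk
    induction k, hk using Nat.le_induction with
    | base =>
      intro hm'
      refine base_conj_mem w1 (base_rotate_pair_mem hn hm h2) fun j => ?_
      have := j.isLt
      simp only [hs]
      split_ifs <;> first | omega | contradiction | (exfalso; lia) | simp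
    | succ k hk ih =>
      intro hkm
      refine base_conj_mem w1 (ih (by omega)) fun j => ?_
      have := j.isLt
      simp only [hs]
      split_ifs <;> first | omega | contradiction | (exfalso; lia) | simp
  have hV : ∀ k : ℕ, 2 * k < m →
      base (fun j : Fin m => if j.val = 0 then tr n hn else if j.val ≤ 2 * k then 1 else
        if j.val = 1 then finRotate n else tr n hn * finRotate n * (tr n hn)⁻¹) ∈ H := by
    intro k
    induction k with
    | zero =>
      intro _
      convert base_twisted_mem hn hm hne h1 h2 using 3
      split_ifs <;> first | rfl | omega
    | succ k ih =>
      intro hk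
      have := H.mul_mem (ih (by omega))
        (H.inv_mem (hp (2 * k + 1) (by omega) (by omega)))
      rw [← map_inv, ← map_mul] at this
      convert this using 2
      funext j
      simp only [Pi.mul_apply, Pi.inv_apply]
      split_ifs <;> first | omega | contradiction | (exfalso; lia) | simp
  obtain ⟨k, hk⟩ := h
  convert hV k (by omega) using 3 with j
  have hj := j.isLt
  split_ifs <;> first | rfl | omega

theorem base_first_tr_mem (h1 : xi1 n m hn hm ∈ H) (h2 : xi2 n m hn hm ∈ H) :
    base (fun j : Fin m => if j.val = 0 then tr n hn else 1) ∈ H := by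
  rcases Nat.even_or_odd m with hme | hmo
  · rcases Nat.even_or_odd n with hne | hno
    · exact base_first_tr_mem_of_even hn hm ⟨hme, hne⟩ h1 h2
    · exact base_first_tr_mem_of_odd_right hn hm hno h1 h2
  · exact base_first_tr_mem_of_odd_left hn hm hmo h1 h2

theorem base_first_mem (h1 : xi1 n m hn hm ∈ H) (h2 : xi2 n m hn hm ∈ H)
    (x : Equiv.Perm (Fin n)) :
    base (Pi.mulSingle (⟨0, by omega⟩ : Fin m) x) ∈ H := by
  set z : Fin m := ⟨0, by omega⟩
  let K : Subgroup (Equiv.Perm (Fin n)) :=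
    H.comap (base.comp (MonoidHom.mulSingle (fun _ : Fin m => Equiv.Perm (Fin n)) z))
  have hK : ∀ y, y ∈ K ↔ base (Pi.mulSingle z y) ∈ H := fun y => Iff.rfl
  have ht : tr n hn ∈ K := by
    rw [hK]
    convert base_first_tr_mem hn hm h1 h2 using 2
    funext j
    simp [Pi.mulSingle_apply, z, Fin.ext_iff]
  have hc : finRotate n ∈ Subgroup.normalizer (K : Set (Equiv.Perm (Fin n))) := by
    have hb := base_rotate_pair_mem hn hm h2
    have e : ∀ y, base (Pi.mulSingle z (finRotate n * y * (finRotate n)⁻¹)) =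
        base (fun j : Fin m => if j.val ≤ 1 then finRotate n else 1) *
          base (Pi.mulSingle z y) *
          (base (fun j : Fin m => if j.val ≤ 1 then finRotate n else 1))⁻¹ := by
      intro y
      rw [← map_inv, ← map_mul, ← map_mul]
      congr 1
      funext j
      by_cases hj : j = z
      · subst hj
        simp [z]
      · simp [hj]
    rw [Subgroup.mem_normalizer_iff]
    intro y
    rw [hK, hK, e, H.mul_mem_cancel_right (H.inv_mem hb), H.mul_mem_cancel_left hb]
  have hN : K.Normal := by
    rw [← Subgroup.normalizer_eq_top_iff, eq_top_iff, ← closure_finRotate_tr n hn,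
      Subgroup.closure_le]
    rintro g (rfl | rfl)
    · exact hc
    · exact Subgroup.le_normalizer ht
  have htop : K = ⊤ := by
    rw [eq_top_iff, ← Equiv.Perm.closure_isSwap, Subgroup.closure_le]
    rintro _ ⟨a, b, hab, rfl⟩
    have hconj : IsConj (tr n hn) (Equiv.swap a b) :=
      Equiv.Perm.isConj_swap (by simp) hab
    obtain ⟨g, hg⟩ := isConj_iff.mp hconj
    rw [← hg]
    exact hN.conj_mem _ ht g
  rw [← hK, htop]
  trivial

theorem base_mulSingle_mem (h1 : xi1 n m hn hm ∈ H) (h2 : xi2 n m hn hm ∈ H)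
    (j : Fin m) (x : Equiv.Perm (Fin n)) : base (Pi.mulSingle j x) ∈ H := by
  have w1 := xi1_eq_wr n m hn hm ▸ h1
  have w2 := xi2_eq_wr n m hn hm ▸ h2
  have move : ∀ {g : Fin m → Equiv.Perm (Fin n)} {s : Equiv.Perm (Fin m)}, wr g s ∈ H →
      ∀ {a b : Fin m}, s a = b → (∀ x, base (Pi.mulSingle a x) ∈ H) →
      ∀ x, base (Pi.mulSingle b x) ∈ H := by
    intro g s hw a b hab ha x
    refine base_conj_mem hw (ha ((g a)⁻¹ * x * g a)) fun j => ?_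
    by_cases hj : j = a
    · subst hj
      simp [hab, mul_assoc]
    · have : s j ≠ b := fun hb => hj (s.injective (hb.trans hab.symm))
      simp [hj, this]
  obtain ⟨k, hk⟩ := j
  revert x
  induction k with
  | zero => exact base_first_mem hn hm h1 h2
  | succ k ih =>
    rcases Nat.eq_zero_or_pos k with rfl | hk0
    · exact move w2 (Fin.ext (by simp [val_tr_apply])) (ih (by omega))
    · refine move w1 (Fin.ext ?_) (ih (by omega))
      by_cases he : Even m ∧ Even n
      · rw [val_sbar_of_even hm he, if_neg (by simp; omega), if_neg (by simp; omega)]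
      · rw [val_sbar_of_not_even hm he, if_neg (by simp; omega)]

theorem base_mem (h1 : xi1 n m hn hm ∈ H) (h2 : xi2 n m hn hm ∈ H)
    (f : Fin m → Equiv.Perm (Fin n)) : base f ∈ H :=
  Subgroup.pi_mem_of_mulSingle_mem (H := H.comap base) f
    fun j => base_mulSingle_mem hn hm h1 h2 j (f j)

/-- A subgroup containing `ξ1` and `ξ2` contains the whole wreath product. -/
theorem wr_mem (h1 : xi1 n m hn hm ∈ H) (h2 : xi2 n m hn hm ∈ H)
    (f : Fin m → Equiv.Perm (Fin n)) (s : Equiv.Perm (Fin m)) : wr f s ∈ H := by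
  let top : Equiv.Perm (Fin m) →* Equiv.Perm (Fin n × Fin m) :=
    { toFun := fun s => wr 1 s
      map_one' := rfl
      map_mul' := fun s r => by rw [wr_mul_wr]; rfl }
  have split : ∀ f s, wr f s = top s * base f := fun f s => by
    ext1 p
    rfl
  have proj : ∀ {f s}, wr f s ∈ H → s ∈ H.comap top := by
    intro f s hw
    rw [split] at hw
    exact (H.mul_mem_cancel_right (base_mem hn hm h1 h2 f)).mp hw
  have hs : sbar n m hm ∈ H.comap top := proj (xi1_eq_wr n m hn hm ▸ h1)
  have ht : tr m hm ∈ H.comap top := proj (xi2_eq_wr n m hn hm ▸ h2)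
  have hr : finRotate m ∈ H.comap top := by
    by_cases he : Even m ∧ Even n
    · have e : sbar n m hm = tr m hm * finRotate m := by
        rw [sbar, if_pos he]; rfl
      rw [e] at hs
      exact (Subgroup.mul_mem_cancel_left _ ht).mp hs
    · rwa [sbar, if_neg he] at hs
  have htop : H.comap top = ⊤ := by
    rw [eq_top_iff, ← closure_finRotate_tr m hm, Subgroup.closure_le]
    rintro g (rfl | rfl)
    · exact hr
    · exact ht
  rw [split]
  refine H.mul_mem ?_ (base_mem hn hm h1 h2 f)
  have : s ∈ H.comap top := htop ▸ Subgroup.mem_top s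
  exact this

end Generation

theorem exists_perm_apply_pair_s14 {X : Type} [DecidableEq X] {a b x y : X} (hab : a ≠ b)
    (hxy : x ≠ y) : ∃ e : Equiv.Perm X, e a = x ∧ e b = y := by
  obtain ⟨e, he⟩ := isConj_iff.mp (Equiv.Perm.isConj_swap hab hxy)
  rw [← Equiv.swap_apply_apply] at he
  have ha : e a = x ∨ e a = y := by
    have : Equiv.swap (e a) (e b) (e a) ≠ e a := by
      rw [Equiv.swap_apply_left]
      exact fun h => hab (e.injective h.symm)
    rw [he] at this
    by_contra! h
    exact this (Equiv.swap_apply_of_ne_of_ne h.1 h.2)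
  have key : e b = Equiv.swap x y (e a) := by rw [← he, Equiv.swap_apply_left]
  rcases ha with h | h
  · exact ⟨e, h, by rw [key, h, Equiv.swap_apply_left]⟩
  · refine ⟨e.trans (Equiv.swap x y), ?_, ?_⟩
    · rw [Equiv.trans_apply, h, Equiv.swap_apply_right]
    · rw [Equiv.trans_apply, key, h, Equiv.swap_apply_right, Equiv.swap_apply_left]

/-- The full transformation monoid of a finite set is generated by the permutations together with
one idempotent of defect one. -/
theorem full_transformation_induction {X : Type} [Fintype X] [DecidableEq X]
    (P : (X → X) → Prop) (hmul : ∀ f g, P f → P g → P (g ∘ f))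
    (hperm : ∀ e : Equiv.Perm X, P e) {a b : X} (hab : a ≠ b)
    (hcol : P (Function.update id a b)) (f : X → X) : P f := by
  have hcol' : ∀ x y, x ≠ y → P (Function.update id x y) := by
    intro x y hxy
    obtain ⟨e, hea, heb⟩ := exists_perm_apply_pair_s14 hab hxy
    have := hmul _ _ (hmul _ _ (hperm e.symm) hcol) (hperm e)
    convert this using 1
    funext z
    by_cases hz : z = x
    · subst hz
      have : e.symm z = a := by rw [← hea, e.symm_apply_apply]
      simp [this, heb]
    · have : e.symm z ≠ a := fun h => hz (by rw [← hea, ← h, e.apply_symm_apply])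
      simp [hz, this]
  induction hd : Fintype.card X - (Finset.univ.image f).card using Nat.strong_induction_on
    generalizing f with
  | _ d ih =>
    by_cases hf : Function.Injective f
    · exact hperm (Equiv.ofBijective f (Finite.injective_iff_bijective.mp hf))
    · have hns : ¬ Function.Surjective f := fun h => hf (Finite.injective_iff_surjective.mpr h)
      simp only [Function.Injective, not_forall] at hf
      obtain ⟨x, y, hxy, hne⟩ := hf
      simp only [Function.Surjective, not_forall, not_exists] at hns
      obtain ⟨w, hw⟩ := hns
      have hfg : f = Function.update f x w ∘ Function.update id x y := by
        funext z
        by_cases hz : z = x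
        · subst hz
          simp [Ne.symm hne, hxy]
        · simp [hz]
      have himg : insert w (Finset.univ.image f) ⊆
          Finset.univ.image (Function.update f x w) := by
        intro z hz
        simp only [Finset.mem_insert, Finset.mem_image, Finset.mem_univ, true_and] at hz ⊢
        rcases hz with rfl | ⟨u, rfl⟩
        · exact ⟨x, by simp⟩
        · by_cases hu : u = x
          · exact ⟨y, by simp [Ne.symm hne, hu, hxy]⟩
          · exact ⟨u, by simp [hu]⟩
      have hcard := Finset.card_le_card himg
      rw [Finset.card_insert_of_notMem (by simpa using hw)] at hcard
      have hle := Finset.card_le_univ (Finset.univ.image (Function.update f x w))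
      rw [hfg]
      exact hmul _ _ (hcol' x y hne) (ih _ (by omega) _ rfl)

/-- The partial transformation monoid of a finite set is generated by the full transformations
together with one partial identity of defect one. -/
theorem partial_transformation_induction {X : Type} [Fintype X] [DecidableEq X]
    (P : (X → Option X) → Prop) (hmul : ∀ f g, P f → P g → P (fun x => (f x).bind g))
    (hfull : ∀ f : X → X, P (fun x => some (f x))) (a : X)
    (hdel : P (fun x => if x = a then none else some x)) (f : X → Option X) : P f := by
  have hdel' : ∀ x, P (fun z => if z = x then none else some z) := by
    intro x
    have := hmul _ _ (hmul _ _ (hfull (Equiv.swap a x)) hdel) (hfull (Equiv.swap a x))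
    convert this using 1
    funext z
    by_cases hz : z = x
    · simp [hz]
    · have : Equiv.swap a x z ≠ a := fun h => hz ((Equiv.swap a x).injective
        (h.trans (Equiv.swap_apply_right a x).symm))
      simp [hz, this]
  induction hd : (Finset.univ.filter fun x => f x = none).card using Nat.strong_induction_on
    generalizing f with
  | _ d ih =>
    by_cases hf : ∃ x, f x = none
    · obtain ⟨x, hx⟩ := hf
      have hfg : f = fun z => (if z = x then none else some z).bind
          (Function.update f x (some x)) := by
        funext z
        by_cases hz : z = x
        · simp [hz, hx]
        · simp [hz]
      rw [hfg]
      refine hmul _ _ (hdel' x) (ih _ ?_ _ rfl)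
      rw [← hd]
      refine Finset.card_lt_card ⟨?_, fun h => ?_⟩
      · intro z hz
        by_cases hzx : z = x
        · simp [hzx] at hz
        · simpa [hzx] using hz
      · have := @h x (by simp [hx])
        simp at this
    · push Not at hf
      choose g hg using fun x => Option.ne_none_iff_exists'.mp (hf x)
      convert hfull g using 1
      exact funext hg

theorem PT.mul_apply {Ω : Type} (α β : PT Ω) (x : Ω) : (α * β) x = (α x).bind β := rfl

theorem PT.ofFun_apply {Ω : Type} (f : Ω → Ω) (x : Ω) : PT.ofFun f x = some (f x) := rfl

theorem PT.some_bind {Ω : Type} (α : PT Ω) (x : Ω) : (some x).bind α = α x := rfl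

theorem PT.mul_eq_some_iff {Ω : Type} {α β : PT Ω} {x z : Ω} :
    (α * β) x = some z ↔ ∃ y, α x = some y ∧ β y = some z := Option.bind_eq_some_iff

theorem PT.ofFun_mul {Ω : Type} (f g : Ω → Ω) : PT.ofFun f * PT.ofFun g = PT.ofFun (g ∘ f) := rfl

/-- The permutations whose associated partial transformation lies in a submonoid. -/
def permSubgroup {Ω : Type} [Finite Ω] (S : Submonoid (PT Ω)) : Subgroup (Equiv.Perm Ω) :=
  let M : Submonoid (Equiv.Perm Ω) :=
    { carrier := {e | PT.ofFun e ∈ S}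
      one_mem' := S.one_mem
      mul_mem' := fun {a b} ha hb => by
        have := S.mul_mem hb ha
        rwa [PT.ofFun_mul] at this }
  { M with
    inv_mem' := fun {a} ha => by
      have h : a⁻¹ = a ^ (orderOf a - 1) := by
        rw [inv_eq_iff_mul_eq_one, ← pow_succ',
          Nat.sub_add_cancel (orderOf_pos a), pow_orderOf_eq_one]
      rw [h]
      exact M.pow_mem ha _ }

theorem mem_permSubgroup {Ω : Type} [Finite Ω] {S : Submonoid (PT Ω)} {e : Equiv.Perm Ω} :
    e ∈ permSubgroup S ↔ PT.ofFun e ∈ S := Iff.rfl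

/-- The partial transformation acting on column `j` by the partial map `a j`. -/
def columnwise {n m : ℕ} (a : Fin m → Fin n → Option (Fin n)) : PT (Fin n × Fin m) :=
  fun p => (a p.2 p.1).map fun i => (i, p.2)

theorem columnwise_mul {n m : ℕ} (a b : Fin m → Fin n → Option (Fin n)) :
    columnwise a * columnwise b = columnwise fun j i => (a j i).bind (b j) := by
  funext p
  simp only [PT.mul_apply, columnwise]
  cases a p.2 p.1 <;> rfl

section MonoidGeneration

variable {n m : ℕ} (hn : 2 ≤ n) (hm : 2 ≤ m) {S : Submonoid (PT (Fin n × Fin m))}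

theorem columnwise_first_mem
    (hwr : ∀ (f : Fin m → Equiv.Perm (Fin n)) (s : Equiv.Perm (Fin m)), PT.ofFun (wr f s) ∈ S)
    (hτ : PT.ofFun (tauF n m hn hm) ∈ S) (hσ : sigmaP n m hn hm ∈ S)
    (a : Fin n → Option (Fin n)) :
    columnwise (fun j : Fin m => if j.val = 0 then a else some) ∈ S := by
  have hmul : ∀ f g : Fin n → Option (Fin n),
      columnwise (fun j : Fin m => if j.val = 0 then f else some) ∈ S →
      columnwise (fun j : Fin m => if j.val = 0 then g else some) ∈ S →
      columnwise (fun j : Fin m => if j.val = 0 then fun x => (f x).bind g else some) ∈ S := by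
    intro f g hf hg
    convert S.mul_mem hf hg using 1
    rw [columnwise_mul]
    congr 1
    funext j i
    split_ifs <;> rfl
  refine partial_transformation_induction _ hmul ?_ ⟨0, by omega⟩ ?_ a
  · refine full_transformation_induction
      (fun f => columnwise (fun j : Fin m => if j.val = 0 then fun x => some (f x) else some) ∈ S)
      (fun f g hf hg => hmul _ _ hf hg) ?_ (a := ⟨0, by omega⟩) (b := ⟨1, by omega⟩) (by simp) ?_
    · intro e
      convert hwr (fun j => if j.val = 0 then e else 1) 1 using 1
      funext p
      simp only [columnwise, PT.ofFun_apply, wr_apply]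
      split_ifs <;> rfl
    · convert hτ using 1
      funext ⟨i, j⟩
      simp only [columnwise, PT.ofFun_apply, tauF, Function.update_apply, Prod.mk.injEq,
        Fin.ext_iff]
      by_cases hj : j.val = 0
      · by_cases hi : i.val = 0
        · simp [hi, hj, Fin.ext_iff]
        · simp [hi, hj]
      · simp [hj]
  · convert hσ using 1
    funext ⟨i, j⟩
    simp only [columnwise, sigmaP, Prod.mk.injEq, Fin.ext_iff]
    split_ifs <;> first | rfl | omega | simp_all

theorem columnwise_mem
    (hwr : ∀ (f : Fin m → Equiv.Perm (Fin n)) (s : Equiv.Perm (Fin m)), PT.ofFun (wr f s) ∈ S)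
    (hτ : PT.ofFun (tauF n m hn hm) ∈ S) (hσ : sigmaP n m hn hm ∈ S)
    (a : Fin m → Fin n → Option (Fin n)) : columnwise a ∈ S := by
  have single : ∀ (k : Fin m) (b : Fin n → Option (Fin n)),
      columnwise (fun j => if j = k then b else some) ∈ S := by
    intro k b
    let z : Fin m := ⟨0, by omega⟩
    have hw := hwr 1 (Equiv.swap z k)
    convert S.mul_mem (S.mul_mem hw (columnwise_first_mem hn hm hwr hτ hσ b)) hw using 1
    funext ⟨i, j⟩
    have hz : (Equiv.swap z k j).val = 0 ↔ j = k := by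
      rw [← Equiv.apply_eq_iff_eq (Equiv.swap z k) (x := j), Equiv.swap_apply_right, Fin.ext_iff]
    simp only [PT.mul_apply, PT.ofFun_apply, PT.some_bind, wr_apply, columnwise, hz]
    by_cases hj : j = k
    · subst hj
      simp only [if_true, Pi.one_apply, Equiv.Perm.one_apply]
      cases b i with
      | none => rfl
      | some x => simp [PT.some_bind, PT.ofFun_apply, wr_apply]
    · simp [hj, PT.some_bind, PT.ofFun_apply, wr_apply]
  have partialProd : ∀ s : Finset (Fin m),
      columnwise (fun j => if j ∈ s then a j else some) ∈ S := by
    intro s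
    induction s using Finset.induction_on with
    | empty =>
      convert S.one_mem using 1
      rfl
    | insert k s hk ih =>
      convert S.mul_mem (single k (a k)) ih using 1
      rw [columnwise_mul]
      congr 1
      funext j i
      by_cases hj : j = k
      · subst hj
        simp only [Finset.mem_insert_self, if_true, hk, if_false]
        cases a j i <;> rfl
      · simp [hj]
  simpa using partialProd Finset.univ

theorem columnMap_mem
    (hwr : ∀ (f : Fin m → Equiv.Perm (Fin n)) (s : Equiv.Perm (Fin m)), PT.ofFun (wr f s) ∈ S)
    (hτ : PT.ofFun (taubarF n m hm) ∈ S) (f : Fin m → Fin m) :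
    PT.ofFun (fun p : Fin n × Fin m => (p.1, f p.2)) ∈ S := by
  refine full_transformation_induction
    (fun f => PT.ofFun (fun p : Fin n × Fin m => (p.1, f p.2)) ∈ S)
    (fun f g hf hg => S.mul_mem hf hg) (fun e => hwr 1 e) (a := ⟨0, by omega⟩)
    (b := ⟨1, by omega⟩) (by simp) ?_ f
  convert hτ using 2
  funext ⟨i, j⟩
  simp only [taubarF, Function.update_apply]
  split_ifs <;> rfl

theorem mem_of_preservesE
    (hwr : ∀ (f : Fin m → Equiv.Perm (Fin n)) (s : Equiv.Perm (Fin m)), PT.ofFun (wr f s) ∈ S)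
    (hτ : PT.ofFun (tauF n m hn hm) ∈ S) (hτ' : PT.ofFun (taubarF n m hm) ∈ S)
    (hσ : sigmaP n m hn hm ∈ S) {α : PT (Fin n × Fin m)} (hα : PreservesE n m α) : α ∈ S := by
  have hf : ∀ j : Fin m, ∃ b : Fin m, ∀ i p, α (i, j) = some p → p.2 = b := by
    intro j
    by_cases h : ∃ i p, α (i, j) = some p
    · obtain ⟨i, p, hp⟩ := h
      exact ⟨p.2, fun k q hq => hα k i j q.1 p.1 q.2 p.2 hq hp⟩
    · push Not at h
      exact ⟨j, fun i p hp => absurd hp (h i p)⟩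
  choose f hf using hf
  convert S.mul_mem
    (columnwise_mem hn hm hwr hτ hσ fun j i => (α (i, j)).map Prod.fst)
    (columnMap_mem hm hwr hτ' f) using 1
  funext ⟨i, j⟩
  simp only [PT.mul_apply, columnwise]
  cases h : α (i, j) with
  | none => rfl
  | some p => simp [PT.some_bind, PT.ofFun_apply, ← hf j i p h]

end MonoidGeneration

/-- The submonoid of `E`-preserving partial transformations. -/
def preservesESubmonoid (n m : ℕ) : Submonoid (PT (Fin n × Fin m)) where
  carrier := {α | PreservesE n m α}
  one_mem' := by
    intro i k j a c b d h1 h2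
    cases h1
    cases h2
    rfl
  mul_mem' := by
    intro α β hα hβ i k j a c b d h1 h2
    rw [PT.mul_eq_some_iff] at h1 h2
    obtain ⟨⟨p, p'⟩, hp, hp'⟩ := h1
    obtain ⟨⟨q, q'⟩, hq, hq'⟩ := h2
    obtain rfl := hα i k j p q p' q' hp hq
    exact hβ p q p' a c b d hp' hq'

theorem preservesE_ofFun {n m : ℕ} {f : Fin n × Fin m → Fin n × Fin m}
    (h : ∀ i k j, (f (i, j)).2 = (f (k, j)).2) : PreservesE n m (PT.ofFun f) := by
  intro i k j a c b d h1 h2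
  have h1' := Option.some.inj h1
  have h2' := Option.some.inj h2
  have := h i k j
  rwa [h1', h2'] at this

theorem preservesE_wr {n m : ℕ} (f : Fin m → Equiv.Perm (Fin n)) (s : Equiv.Perm (Fin m)) :
    PreservesE n m (PT.ofFun (wr f s)) :=
  preservesE_ofFun fun _ _ _ => rfl

theorem preservesE_tauF (n m : ℕ) (hn : 2 ≤ n) (hm : 2 ≤ m) :
    PreservesE n m (PT.ofFun (tauF n m hn hm)) := by
  have : ∀ p, (tauF n m hn hm p).2 = p.2 := by
    intro p
    rw [tauF]
    split_ifs with h
    · rw [h]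
    · rfl
  exact preservesE_ofFun fun i k j => by rw [this, this]

theorem preservesE_taubarF (n m : ℕ) (hm : 2 ≤ m) :
    PreservesE n m (PT.ofFun (taubarF n m hm)) := by
  refine preservesE_ofFun fun i k j => ?_
  simp only [taubarF]
  split_ifs <;> rfl

theorem closure_eq_preservesE (n m : ℕ) (hn : 2 ≤ n) (hm : 2 ≤ m) :
    (Submonoid.closure
          {PT.ofFun ⇑(xi1 n m hn hm), PT.ofFun ⇑(xi2 n m hn hm),
            PT.ofFun (tauF n m hn hm), PT.ofFun (taubarF n m hm), sigmaP n m hn hm}) =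
      preservesESubmonoid n m := by
  refine le_antisymm ?_ fun α hα => ?_
  · rw [Submonoid.closure_le]
    rintro _ (rfl | rfl | rfl | rfl | rfl)
    · rw [xi1_eq_wr]
      exact preservesE_wr _ _
    · rw [xi2_eq_wr]
      exact preservesE_wr _ _
    · exact preservesE_tauF n m hn hm
    · exact preservesE_taubarF n m hm
    · exact preservesE_sigmaP n m hn hm
  · refine mem_of_preservesE hn hm (fun f s => ?_) (Submonoid.subset_closure (by simp))
      (Submonoid.subset_closure (by simp)) (Submonoid.subset_closure (by simp)) hα
    rw [← mem_permSubgroup]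
    exact wr_mem hn hm (mem_permSubgroup.mpr (Submonoid.subset_closure (by simp)))
      (mem_permSubgroup.mpr (Submonoid.subset_closure (by simp))) f s

/-- The partial transformations that are permutations. -/
def PT.IsPerm {Ω : Type} (α : PT Ω) : Prop := ∃ e : Equiv.Perm Ω, α = PT.ofFun e

theorem PT.exists_eq_ofFun {Ω : Type} {α : PT Ω} (h : ∀ x, α x ≠ none) :
    ∃ f : Ω → Ω, α = PT.ofFun f := by
  choose f hf using fun x => Option.ne_none_iff_exists'.mp (h x)
  exact ⟨f, funext hf⟩

theorem PT.isPerm_ofFun {Ω : Type} [Finite Ω] {f : Ω → Ω} (hf : Function.Injective f) :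
    (PT.ofFun f).IsPerm :=
  ⟨Equiv.ofBijective f (Finite.injective_iff_bijective.mp hf), rfl⟩

theorem PT.IsPerm.mul {Ω : Type} {α β : PT Ω} (hα : α.IsPerm) (hβ : β.IsPerm) :
    (α * β).IsPerm := by
  obtain ⟨e, rfl⟩ := hα
  obtain ⟨e', rfl⟩ := hβ
  exact ⟨e.trans e', rfl⟩

theorem PT.isPerm_of_mul {Ω : Type} [Finite Ω] {α β : PT Ω} (h : (α * β).IsPerm) :
    α.IsPerm ∧ β.IsPerm := by
  obtain ⟨e, he⟩ := h
  have hfull : ∀ x, α x ≠ none := by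
    intro x hx
    have h1 := congrFun he x
    rw [PT.mul_apply, hx] at h1
    cases h1
  obtain ⟨f, rfl⟩ := PT.exists_eq_ofFun hfull
  have hβ : ∀ x, β (f x) = some (e x) := fun x => congrFun he x
  have hf : Function.Injective f := by
    intro x y hxy
    have h1 := hβ x
    rw [hxy, hβ y] at h1
    exact (e.injective (Option.some.inj h1)).symm
  obtain ⟨g, hg⟩ := PT.isPerm_ofFun hf
  refine ⟨⟨g, hg⟩, g.symm.trans e, funext fun x => ?_⟩
  have hfg : f (g.symm x) = x := by
    have h1 := Option.some.inj (congrFun hg (g.symm x))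
    rw [h1, g.apply_symm_apply]
  have h2 := hβ (g.symm x)
  rw [hfg] at h2
  exact h2

/-- A non-permutation in the closure of `X` has a first non-permutation factor. -/
theorem exists_factor_of_not_isPerm {Ω : Type} {X : Set (PT Ω)} {γ : PT Ω}
    (hγ : γ ∈ Submonoid.closure X) (hp : ¬ γ.IsPerm) :
    ∃ (g : Equiv.Perm Ω) (x r : PT Ω), PT.ofFun g ∈ Submonoid.closure X ∧ x ∈ X ∧ ¬ x.IsPerm ∧
      γ = PT.ofFun g * x * r := by
  induction hγ using Submonoid.closure_induction_left with
  | one => exact absurd ⟨1, rfl⟩ hp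
  | mul_left x hx y hy ih =>
    by_cases hxp : x.IsPerm
    · obtain ⟨g, z, r, hg, hz, hzp, e⟩ := ih fun hyp => hp (hxp.mul hyp)
      obtain ⟨e', rfl⟩ := hxp
      refine ⟨e'.trans g, z, r, ?_, hz, hzp, ?_⟩
      · exact Submonoid.mul_mem _ (Submonoid.subset_closure hx) hg
      · rw [e, ← mul_assoc, ← mul_assoc, PT.ofFun_mul, Equiv.coe_trans]
    · exact ⟨1, x, y, Submonoid.one_mem _, hx, hxp, rfl⟩

theorem mem_closure_isPerm {Ω : Type} [Finite Ω] {X : Set (PT Ω)} {γ : PT Ω}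
    (hγ : γ ∈ Submonoid.closure X) (hp : γ.IsPerm) :
    γ ∈ Submonoid.closure {x ∈ X | x.IsPerm} := by
  induction hγ using Submonoid.closure_induction_left with
  | one => exact Submonoid.one_mem _
  | mul_left x hx y hy ih =>
    obtain ⟨hxp, hyp⟩ := PT.isPerm_of_mul hp
    exact Submonoid.mul_mem _ (Submonoid.subset_closure ⟨hx, hxp⟩) (ih hyp)

/-- The first non-permutation factor of a full transformation is full, not injective, and its
kernel lies in the image of the kernel of the product. -/
theorem exists_collapsing_factor {Ω : Type} [Finite Ω] {X : Set (PT Ω)} {f : Ω → Ω}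
    (hγ : PT.ofFun f ∈ Submonoid.closure X) (hf : ¬ Function.Injective f) :
    ∃ (g : Equiv.Perm Ω) (h : Ω → Ω), PT.ofFun g ∈ Submonoid.closure X ∧ PT.ofFun h ∈ X ∧
      ¬ Function.Injective h ∧ ∀ p q, h (g p) = h (g q) → f p = f q := by
  have hp : ¬ (PT.ofFun f).IsPerm := by
    rintro ⟨e, he⟩
    refine hf fun p q hpq => e.injective ?_
    have h1 : ∀ p, f p = e p := fun p => Option.some.inj (congrFun he p)
    rw [← h1, ← h1, hpq]
  obtain ⟨g, x, r, hg, hx, hxp, e⟩ := exists_factor_of_not_isPerm hγ hp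
  have he : ∀ p, (x (g p)).bind r = some (f p) := fun p => (congrFun e p).symm
  have hfull : ∀ p, x p ≠ none := by
    intro p hxp
    have h1 := he (g.symm p)
    rw [g.apply_symm_apply, hxp] at h1
    cases h1
  obtain ⟨h, rfl⟩ := PT.exists_eq_ofFun hfull
  refine ⟨g, h, hg, hx, fun hinj => hxp (PT.isPerm_ofFun hinj), fun p q hpq => ?_⟩
  have h1 : r (h (g p)) = some (f p) := he p
  have h2 : r (h (g q)) = some (f q) := he q
  rw [hpq, h2] at h1
  exact (Option.some.inj h1).symm

/-- The first non-permutation factor of an injective partial transformation is not full. -/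
theorem exists_partial_factor {Ω : Type} [Finite Ω] {X : Set (PT Ω)} {γ : PT Ω}
    (hγ : γ ∈ Submonoid.closure X) (hinj : ∀ p q, p ≠ q → γ p = γ q → γ p = none)
    (hp : ¬ γ.IsPerm)
    (hexc : ∀ p q, γ p = none → γ q = none → p = q) :
    ∃ x ∈ X, ¬ x.IsPerm ∧ ∃ p, x p = none := by
  obtain ⟨g, x, r, hg, hx, hxp, e⟩ := exists_factor_of_not_isPerm hγ hp
  refine ⟨x, hx, hxp, ?_⟩
  by_contra! hfull
  obtain ⟨h, rfl⟩ := PT.exists_eq_ofFun hfull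
  refine hxp (PT.isPerm_ofFun fun p q hpq => ?_)
  have he : ∀ p, γ p = r (h (g p)) := fun p => congrFun e p
  by_contra hne
  have hne' : g.symm p ≠ g.symm q := fun h => hne (g.symm.injective h)
  have heq : γ (g.symm p) = γ (g.symm q) := by
    rw [he, he, g.apply_symm_apply, g.apply_symm_apply, hpq]
  have hnone := hinj _ _ hne' heq
  exact hne' (hexc _ _ hnone (heq ▸ hnone))

theorem PreservesE.perm_snd_eq_iff {n m : ℕ} {g : Equiv.Perm (Fin n × Fin m)}
    (hg : PreservesE n m (PT.ofFun g)) (p q : Fin n × Fin m) :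
    (g p).2 = (g q).2 ↔ p.2 = q.2 := by
  have hpres : ∀ i k j, (g (i, j)).2 = (g (k, j)).2 := fun i k j =>
    hg i k j (g (i, j)).1 (g (k, j)).1 _ _ rfl rfl
  let f : Fin m → Fin m := fun j => (g (p.1, j)).2
  have hf : ∀ q, (g q).2 = f q.2 := fun q => hpres q.1 p.1 q.2
  have hsurj : Function.Surjective f := fun j =>
    ⟨(g.symm (p.1, j)).2, by rw [← hf, g.apply_symm_apply]⟩
  rw [hf, hf]
  exact (Finite.injective_iff_surjective.mpr hsurj).eq_iff

theorem five_le_card_of_closure_eq {n m : ℕ} (hn : 2 ≤ n) (hm : 2 ≤ m)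
    (X : Finset (PT (Fin n × Fin m)))
    (hX : Submonoid.closure (X : Set (PT (Fin n × Fin m))) = preservesESubmonoid n m) :
    5 ≤ X.card := by
  classical
  have hmem : ∀ {α}, PreservesE n m α → α ∈ Submonoid.closure (X : Set (PT (Fin n × Fin m))) :=
    fun {α} hα => hX ▸ (show α ∈ preservesESubmonoid n m from hα)
  have hpres : ∀ {α}, α ∈ Submonoid.closure (X : Set (PT (Fin n × Fin m))) → PreservesE n m α :=
    fun {α} hα => show α ∈ preservesESubmonoid n m from hX ▸ hα
  let i0 : Fin n := ⟨0, by omega⟩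
  let i1 : Fin n := ⟨1, by omega⟩
  let j0 : Fin m := ⟨0, by omega⟩
  let j1 : Fin m := ⟨1, by omega⟩
  have hi : i0 ≠ i1 := by simp [i0, i1]
  have hj : j0 ≠ j1 := by simp [j0, j1]
  have hunits : 2 ≤ (X.filter PT.IsPerm).card := by
    by_contra! hlt
    have hcomm : ∀ x ∈ {x ∈ (X : Set (PT (Fin n × Fin m))) | x.IsPerm},
        ∀ y ∈ {x ∈ (X : Set (PT (Fin n × Fin m))) | x.IsPerm}, x * y = y * x := by
      intro x hx y hy
      have hxy : x = y := Finset.card_le_one.mp (Nat.lt_succ_iff.mp hlt)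
        x (by simpa using hx) y (by simpa using hy)
      rw [hxy]
    let a : PT (Fin n × Fin m) := PT.ofFun (wr (fun j => if j = j0 then Equiv.swap i0 i1 else 1) 1)
    let b : PT (Fin n × Fin m) := PT.ofFun (wr 1 (Equiv.swap j0 j1))
    have ha := mem_closure_isPerm (γ := a) (hmem (preservesE_wr _ _)) ⟨_, rfl⟩
    have hb := mem_closure_isPerm (γ := b) (hmem (preservesE_wr _ _)) ⟨_, rfl⟩
    have hab : a * b = b * a := by
      have hc : Submonoid.closure {x ∈ (X : Set (PT (Fin n × Fin m))) | x.IsPerm} ≤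
          Submonoid.centralizer {b} := by
        rw [Submonoid.closure_le]
        intro x hx
        have hb' : Submonoid.closure {x ∈ (X : Set (PT (Fin n × Fin m))) | x.IsPerm} ≤
            Submonoid.centralizer {x} := by
          rw [Submonoid.closure_le]
          intro y hy
          simpa [Set.mem_centralizer_iff] using hcomm x hx y hy
        have := hb' hb
        simp only [Submonoid.mem_centralizer_iff, Set.mem_singleton_iff, forall_eq] at this
        simpa [Set.mem_centralizer_iff] using this.symm
      have := hc ha
      simp only [Submonoid.mem_centralizer_iff, Set.mem_singleton_iff, forall_eq] at this
      exact this.symm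
    have h1 := congrFun hab (i0, j0)
    simp [a, b, PT.mul_apply, PT.ofFun_apply, PT.some_bind, wr_apply, hj.symm, hi.symm] at h1
  obtain ⟨g₁, h₁, hg₁, hx₁, hn₁, hk₁⟩ := exists_collapsing_factor
    (f := tauF n m hn hm) (hmem (preservesE_tauF n m hn hm))
    (fun h => hi (congrArg Prod.fst (@h (i0, j0) (i1, j0) (by simp [tauF, i0, i1, j0]))))
  obtain ⟨g₂, h₂, hg₂, hx₂, hn₂, hk₂⟩ := exists_collapsing_factor
    (f := taubarF n m hm) (hmem (preservesE_taubarF n m hm))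
    (fun h => hj (congrArg Prod.snd (@h (i0, j0) (i0, j1) (by simp [taubarF, j0, j1]))))
  obtain ⟨x₃, hx₃, hn₃, p₃, hp₃⟩ := exists_partial_factor
    (γ := sigmaP n m hn hm) (hmem (preservesE_sigmaP n m hn hm))
    (by
      intro p q hpq h
      simp only [sigmaP] at h ⊢
      split_ifs at h ⊢ <;> simp_all)
    (by
      rintro ⟨e, he⟩
      have := congrFun he (i0, j0)
      simp [sigmaP, i0, j0, PT.ofFun_apply] at this)
    (by
      intro p q hp hq
      simp only [sigmaP] at hp hq
      split_ifs at hp hq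
      simp_all)
  have hnp : ∀ {h : Fin n × Fin m → Fin n × Fin m}, ¬ Function.Injective h →
      ¬ (PT.ofFun h).IsPerm := by
    rintro h hh ⟨e, he⟩
    have heq : h = e := funext fun p => Option.some.inj (congrFun he p)
    exact hh (heq ▸ e.injective)
  have h12 : PT.ofFun h₁ ≠ PT.ofFun h₂ := by
    intro he
    have heq : h₁ = h₂ := funext fun p => Option.some.inj (congrFun he p)
    subst heq
    simp only [Function.Injective, not_forall] at hn₁
    obtain ⟨p, q, hpq, hne⟩ := hn₁
    have hcol : p.2 = q.2 := by
      have h := hk₁ (g₁.symm p) (g₁.symm q) (by simpa using hpq)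
      have hcol' : (g₁.symm p).2 = (g₁.symm q).2 := by
        simp only [tauF] at h
        split_ifs at h <;> simp_all [Prod.ext_iff]
      simpa using ((hpres hg₁).perm_snd_eq_iff _ _).mpr hcol'
    have h := hk₂ (g₂.symm p) (g₂.symm q) (by simpa using hpq)
    have hcol' : (g₂.symm p).2 = (g₂.symm q).2 :=
      ((hpres hg₂).perm_snd_eq_iff _ _).mp (by simpa using hcol)
    refine hne (g₂.symm.injective (Prod.ext ?_ hcol'))
    simp only [taubarF, hcol'] at h
    split_ifs at h
    · exact (Prod.mk.inj h).1
    · exact congrArg Prod.fst h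
  have h3 : ∀ h : Fin n × Fin m → Fin n × Fin m, PT.ofFun h ≠ x₃ := by
    rintro h rfl
    cases hp₃
  have hnonunits : 3 ≤ (X.filter fun x => ¬ x.IsPerm).card := by
    have hsub : {PT.ofFun h₁, PT.ofFun h₂, x₃} ⊆ X.filter fun x => ¬ x.IsPerm := by
      intro x hx
      simp only [Finset.mem_insert, Finset.mem_singleton] at hx
      rw [Finset.mem_filter]
      rcases hx with rfl | rfl | rfl
      · exact ⟨hx₁, hnp hn₁⟩
      · exact ⟨hx₂, hnp hn₂⟩
      · exact ⟨hx₃, hn₃⟩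
    rw [← Finset.card_eq_three.mpr ⟨_, _, _, h12, h3 h₁, h3 h₂, rfl⟩]
    exact Finset.card_le_card hsub
  have := Finset.card_filter_add_card_filter_not (s := X) PT.IsPerm
  omega

/-- `{ξ1, ξ2, τ, τ̄, σ}` is a generating set of `PT_{n×m}` of minimal cardinality:
it generates `PT_{n×m}`, and no subset of cardinality at most 4 generates it. -/
theorem stmt14 (n m : ℕ) (hn : 2 ≤ n) (hm : 2 ≤ m) :
    ↑(Submonoid.closure
          {PT.ofFun ⇑(xi1 n m hn hm), PT.ofFun ⇑(xi2 n m hn hm),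
            PT.ofFun (tauF n m hn hm), PT.ofFun (taubarF n m hm), sigmaP n m hn hm}) =
        {α : PT (Fin n × Fin m) | PreservesE n m α} ∧
      ∀ X : Finset (PT (Fin n × Fin m)), X.card ≤ 4 →
        (X : Set (PT (Fin n × Fin m))) ⊆ {α | PreservesE n m α} →
          ↑(Submonoid.closure (X : Set (PT (Fin n × Fin m)))) ≠
            {α : PT (Fin n × Fin m) | PreservesE n m α} := by
  refine ⟨?_, fun X hX _ h => ?_⟩
  · rw [closure_eq_preservesE]
    rfl
  · have := five_le_card_of_closure_eq hn hm X (SetLike.coe_injective h)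
    omega
end

section
/- Let n, m ≥ 2 and let X be a subset of PT_{n×m} such that X together with the group S_{n×m} of E-preserving permutations generates PT_{n×m} as a monoid. Then X contains a full transformation of rank nm − 1 and a strictly partial transformation of rank nm − 1. -/
/-- The image of a partial transformation. -/
def PT.image {Ω : Type} (α : PT Ω) : Set Ω := {y | ∃ x, α x = some y}

/-- The `E`-preserving permutations of `Fin n × Fin m`, as partial transformations. -/
def PermE (n m : ℕ) : Set (PT (Fin n × Fin m)) :=
  {α | ∃ π : Equiv.Perm (Fin n × Fin m),
    (∀ (i k : Fin n) (j : Fin m), (π (i, j)).2 = (π (k, j)).2) ∧ α = PT.ofFun ⇑π}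

theorem PT.ofFun_mul_apply {Ω : Type} (f : Ω → Ω) (α : PT Ω) (x : Ω) :
    (PT.ofFun f * α) x = α (f x) := rfl

theorem PT.image_ofFun_mul {Ω : Type} (π : Equiv.Perm Ω) (α : PT Ω) :
    (PT.ofFun π * α).image = α.image := by
  ext y
  exact π.exists_congr_left.trans (by simp [PT.ofFun_mul_apply, PT.image])

theorem PT.ncard_image_mul_le {Ω : Type} [Finite Ω] (α β : PT Ω) :
    (α * β).image.ncard ≤ α.image.ncard := by
  calc (α * β).image.ncard ≤ ((fun y => (β y).getD y) '' α.image).ncard := by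
        refine Set.ncard_le_ncard ?_ (Set.toFinite _)
        rintro z ⟨x, hx⟩
        obtain ⟨y, hxy, hyz⟩ := Option.bind_eq_some_iff.mp hx
        exact ⟨y, ⟨x, hxy⟩, by simp [hyz]⟩
    _ ≤ α.image.ncard := Set.ncard_image_le (Set.toFinite _)

theorem PermE.mul_mem {n m : ℕ} {α β : PT (Fin n × Fin m)}
    (hα : α ∈ PermE n m) (hβ : β ∈ PermE n m) : α * β ∈ PermE n m := by
  obtain ⟨π, hπ, rfl⟩ := hα
  obtain ⟨σ, hσ, rfl⟩ := hβ
  refine ⟨π.trans σ, fun i k j => ?_, rfl⟩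
  have h := hσ (π (i, j)).1 (π (k, j)).1 (π (i, j)).2
  rwa [show ((π (k, j)).1, (π (i, j)).2) = π (k, j) from Prod.ext rfl (hπ i k j)] at h

/-- A surjective `E`-preserving partial transformation is an `E`-preserving permutation. -/
theorem PreservesE.mem_permE {n m : ℕ} {α : PT (Fin n × Fin m)} (hα : PreservesE n m α)
    (hsurj : α.image = Set.univ) : α ∈ PermE n m := by
  have h : ∀ y, ∃ x, α x = some y := fun y => by
    have : y ∈ α.image := hsurj ▸ Set.mem_univ y
    exact this
  choose s hs using h
  have hinj : Function.Injective s := fun a b hab =>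
    Option.some_injective _ ((hs a).symm.trans (hab ▸ hs b))
  let e := Equiv.ofBijective s (Finite.injective_iff_bijective.mp hinj)
  have he : ∀ x, α x = some (e.symm x) := fun x => by
    have := hs (e.symm x)
    rwa [show s (e.symm x) = x from e.apply_symm_apply x] at this
  exact ⟨e.symm, fun i k j => hα i k j _ _ _ _ (he (i, j)) (he (k, j)), funext he⟩

/-- An element generated by `X` and the `E`-preserving permutations is either such a permutation
or has a first factor in `X` that is not one. -/
theorem mem_permE_or_exists_factor {n m : ℕ} {X : Set (PT (Fin n × Fin m))}
    {α : PT (Fin n × Fin m)} (hα : α ∈ Submonoid.closure (X ∪ PermE n m)) :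
    α ∈ PermE n m ∨ ∃ π ∈ PermE n m, ∃ g ∈ X, g ∉ PermE n m ∧ ∃ h, α = π * (g * h) := by
  have one_mem : (1 : PT (Fin n × Fin m)) ∈ PermE n m := ⟨1, fun _ _ _ => rfl, rfl⟩
  induction hα using Submonoid.closure_induction_left with
  | one => exact .inl one_mem
  | mul_left x hx y _ ih =>
    by_cases hxp : x ∈ PermE n m
    · rcases ih with hy | ⟨π, hπ, g, hg, hgp, h, rfl⟩
      · exact .inl (PermE.mul_mem hxp hy)
      · exact .inr ⟨x * π, PermE.mul_mem hxp hπ, g, hg, hgp, h, (mul_assoc _ _ _).symm⟩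
    · exact .inr ⟨1, one_mem, x, hx.resolve_right hxp, hxp, y, (one_mul _).symm⟩

/-- An element of rank `nm - 1` generated by `X` and the `E`-preserving permutations has, up to a
permutation on the left, a left factor in `X` of rank `nm - 1`. -/
theorem exists_factor_ncard_image_eq {n m : ℕ} (hnm : 0 < n * m) {X : Set (PT (Fin n × Fin m))}
    (hX : X ⊆ {α | PreservesE n m α}) {α : PT (Fin n × Fin m)}
    (hα : α ∈ Submonoid.closure (X ∪ PermE n m)) (hrank : α.image.ncard = n * m - 1) :
    ∃ (π : Equiv.Perm (Fin n × Fin m)), ∃ g ∈ X, g.image.ncard = n * m - 1 ∧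
      ∃ h, α = PT.ofFun π * (g * h) := by
  have hcard : Nat.card (Fin n × Fin m) = n * m := by simp
  rcases mem_permE_or_exists_factor hα with ⟨π, -, rfl⟩ | ⟨_, ⟨π, -, rfl⟩, g, hg, hgp, h, rfl⟩
  · have himage : (PT.ofFun π).image = Set.univ :=
      Set.eq_univ_of_forall fun y => ⟨π.symm y, by simp [PT.ofFun]⟩
    rw [himage, Set.ncard_univ, hcard] at hrank
    omega
  · refine ⟨π, g, hg, ?_, h, rfl⟩
    rw [PT.image_ofFun_mul] at hrank
    have hge := PT.ncard_image_mul_le g h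
    have hlt : g.image.ncard < Nat.card (Fin n × Fin m) :=
      Set.ncard_lt_card fun huniv => hgp ((hX hg).mem_permE huniv)
    omega

theorem ncard_compl_singleton_fin_prod {n m : ℕ} (p : Fin n × Fin m) :
    ({p}ᶜ : Set (Fin n × Fin m)).ncard = n * m - 1 := by
  rw [Set.ncard_compl, Set.ncard_singleton, Nat.card_prod, Nat.card_fin, Nat.card_fin]

/-- If `X ⊆ PT_{n×m}` and `X` together with the `E`-preserving permutations generates
`PT_{n×m}`, then `X` contains a full transformation of rank `nm - 1` and a strictly
partial transformation of rank `nm - 1`. -/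
theorem stmt18 (n m : ℕ) (hn : 2 ≤ n) (hm : 2 ≤ m)
    (X : Set (PT (Fin n × Fin m)))
    (hXsub : X ⊆ {α | PreservesE n m α})
    (hgen : ↑(Submonoid.closure
        (X ∪ {α : PT (Fin n × Fin m) | ∃ π : Equiv.Perm (Fin n × Fin m),
            (∀ (i k : Fin n) (j : Fin m), (π (i, j)).2 = (π (k, j)).2) ∧
              α = PT.ofFun ⇑π})) =
      {α : PT (Fin n × Fin m) | PreservesE n m α}) :
    (∃ α ∈ X, (∀ x, α x ≠ none) ∧
        {y : Fin n × Fin m | ∃ x, α x = some y}.ncard = n * m - 1) ∧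
      ∃ α ∈ X, (∃ x, α x = none) ∧
        {y : Fin n × Fin m | ∃ x, α x = some y}.ncard = n * m - 1 := by
  have hnm : 0 < n * m := by positivity
  have hmem : ∀ α, PreservesE n m α → α ∈ Submonoid.closure (X ∪ PermE n m) :=
    fun α hα => hgen.symm.subset hα
  let p : Fin n × Fin m := (⟨0, by omega⟩, ⟨0, by omega⟩)
  let q : Fin n × Fin m := (⟨1, by omega⟩, ⟨0, by omega⟩)
  have hqp : q ≠ p := by simp [p, q]
  constructor
  · let β : PT (Fin n × Fin m) := PT.ofFun fun x => if x = p then q else x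
    have hsnd : ∀ x : Fin n × Fin m, (if x = p then q else x).2 = x.2 := by
      intro x
      split_ifs with h
      · rw [h]
      · rfl
    have hβ : PreservesE n m β := by
      intro i k j a c b d h₁ h₂
      have e₁ := congrArg Prod.snd (Option.some_injective _ h₁)
      have e₂ := congrArg Prod.snd (Option.some_injective _ h₂)
      exact e₁.symm.trans ((hsnd (i, j)).trans ((hsnd (k, j)).symm.trans e₂))
    have himage : β.image = {p}ᶜ := by
      ext y
      constructor
      · rintro ⟨x, hx⟩ rfl
        have hx := Option.some_injective _ hx
        by_cases h : x = p <;> simp_all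
      · exact fun hy => ⟨y, congrArg some (if_neg hy)⟩
    obtain ⟨π, g, hg, hrank, h, hfac⟩ := exists_factor_ncard_image_eq hnm hXsub (hmem β hβ)
      (himage ▸ ncard_compl_singleton_fin_prod p)
    refine ⟨g, hg, fun x hx => ?_, hrank⟩
    have hnone := congrFun hfac (π.symm x)
    rw [PT.ofFun_mul_apply, Equiv.apply_symm_apply, PT.mul_apply, hx] at hnone
    exact Option.some_ne_none _ hnone
  · let γ : PT (Fin n × Fin m) := fun x => if x = p then none else some x
    have hγ_some : ∀ {x y}, γ x = some y ↔ x ≠ p ∧ x = y := by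
      intro x y
      simp [γ]
    have hγ : PreservesE n m γ := by
      intro i k j a c b d h₁ h₂
      have e₁ := congrArg Prod.snd (hγ_some.mp h₁).2
      have e₂ := congrArg Prod.snd (hγ_some.mp h₂).2
      exact e₁.symm.trans e₂
    have himage : γ.image = {p}ᶜ := by
      ext y
      simp [PT.image, hγ_some]
    have hinj : Function.Injective γ := by
      intro x y hxy
      by_cases hx : x = p <;> by_cases hy : y = p <;> simp_all [γ]
    obtain ⟨π, g, hg, hrank, h, hfac⟩ := exists_factor_ncard_image_eq hnm hXsub (hmem γ hγ)
      (himage ▸ ncard_compl_singleton_fin_prod p)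
    refine ⟨g, hg, ?_, hrank⟩
    by_contra! hfull
    choose f hf using fun x => Option.ne_none_iff_exists'.mp (hfull x)
    have hfinj : Function.Injective f := by
      intro x y hxy
      apply π.symm.injective
      apply hinj
      rw [hfac, PT.ofFun_mul_apply, PT.ofFun_mul_apply, Equiv.apply_symm_apply,
        Equiv.apply_symm_apply, PT.mul_apply, PT.mul_apply, hf, hf, hxy]
    have huniv : g.image = Set.univ := Set.eq_univ_of_forall fun y => by
      obtain ⟨x, rfl⟩ := Finite.surjective_of_injective hfinj y
      exact ⟨x, hf x⟩
    rw [huniv, Set.ncard_univ] at hrank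
    simp at hrank
    omega
end
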